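/- For all n > 2 and every partition λ of 2n with λ ≠ (2n-2, 2), the Hall inner product satisfies ⟨h_n[h_1 h_1], s_λ⟩ ≥ ⟨h_2[h_1 h_{n-1}], s_λ⟩; moreover ⟨h_n[h_1 h_1], s_{(2n-2,2)}⟩ = 2 and ⟨h_2[h_1 h_{n-1}], s_{(2n-2,2)}⟩ = 3. -/

import Mathlib

open MvPolynomial

/-- The ring of symmetric functions, modeled as the polynomial ring
`ℚ[h₁, h₂, …]` in the complete homogeneous symmetric functions (variable `i`
corresponds to `h_{i+1}`). -/
abbrev SymF : Type := MvPolynomial ℕ ℚ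

/-- The complete homogeneous symmetric function `h_n` as an element of `SymF`. -/
noncomputable def hh : ℕ → SymF
  | 0 => 1
  | n + 1 => X n

/-- The expression of `h_n` in terms of the power sums (in the polynomial ring
`ℚ[p₁, p₂, …]`, variable `i` corresponding to `p_{i+1}`), via Newton's identity
`n·h_n = ∑_{i=1}^n p_i h_{n-i}`. -/
noncomputable def hInP : ℕ → MvPolynomial ℕ ℚ
  | 0 => 1
  | n + 1 =>
      ((n + 1 : ℚ))⁻¹ • ∑ i ∈ Finset.range (n + 1), X i * hInP (n - i)
  termination_by n => n
  decreasing_by omega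

/-- The power sum symmetric function `p_n` as an element of `SymF`, via Newton's
identity `p_n = n·h_n - ∑_{i=1}^{n-1} p_i h_{n-i}`. -/
noncomputable def pSym : ℕ → SymF
  | 0 => 1
  | n + 1 =>
      ((n : ℚ) + 1) • hh (n + 1) -
        ∑ i ∈ (Finset.range n).attach, pSym (i.1 + 1) * hh (n - i.1)
  termination_by n => n
  decreasing_by
    have h := Finset.mem_range.mp i.2
    omega

/-- The isomorphism expressing a symmetric function in the power sum basis. -/
noncomputable def toP : SymF →ₐ[ℚ] MvPolynomial ℕ ℚ :=
  aeval (fun i => hInP (i + 1))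

/-- `psub k g = p_k[g]`, plethysm of a power sum with `g`: substitute `p_i ↦ p_{ik}`
in the power-sum expression of `g`. -/
noncomputable def psub (k : ℕ) (g : SymF) : SymF :=
  aeval (fun i => pSym ((i + 1) * k)) (toP g)

/-- Plethysm `f[g]` of symmetric functions: substitute `p_k ↦ p_k[g]` in the
power-sum expression of `f`. -/
noncomputable def pleth (f g : SymF) : SymF :=
  aeval (fun i => psub (i + 1) g) (toP f)

/-- `h_z` for integer index: zero for negative `z`. -/
noncomputable def hZ (z : ℤ) : SymF := if 0 ≤ z then hh z.toNat else 0

/-- The Schur function of a partition given as a weakly decreasing list of parts,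
defined by the Jacobi–Trudi determinant `s_λ = det(h_{λ_i - i + j})`. -/
noncomputable def schur (l : List ℕ) : SymF :=
  (Matrix.of fun i j : Fin l.length =>
    hZ ((l.get i : ℤ) + (j : ℤ) - (i : ℤ))).det

/-- `z_λ` for the monomial `d` in the power sums: `∏_i i^{m_i} m_i!`. -/
def zQ (d : ℕ →₀ ℕ) : ℚ :=
  d.prod fun i m => ((i : ℚ) + 1) ^ m * (Nat.factorial m : ℚ)

/-- The Hall inner product, characterized by `⟨p_λ, p_μ⟩ = δ_{λμ} z_λ`, computed in
the power sum basis. -/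
noncomputable def hall (f g : SymF) : ℚ :=
  ∑ d ∈ (toP f).support, zQ d * (toP f).coeff d * (toP g).coeff d

/-- The decreasingly sorted list of parts of a partition. -/
def sortedParts {N : ℕ} (π : Nat.Partition N) : List ℕ :=
  (π.parts.sort (· ≤ ·)).reverse

namespace Representation

open Module

variable {G V W : Type} [Group G] [AddCommGroup V] [Module ℚ V] [FiniteDimensional ℚ V]
  [AddCommGroup W] [Module ℚ W]

theorem character_eq_add_of_isCompl (ρ : Representation ℚ G V) {p q : Subrepresentation ρ}
    (h : IsCompl p q) (g : G) :
    ρ.character g = p.toRepresentation.character g + q.toRepresentation.character g := by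
  have h' : IsCompl p.toSubmodule q.toSubmodule := by
    constructor
    · rw [disjoint_iff, ← Subrepresentation.toSubmodule_inf, disjoint_iff.mp h.1]; rfl
    · rw [codisjoint_iff, ← Subrepresentation.toSubmodule_sup, codisjoint_iff.mp h.2]; rfl
  have hconj : ρ g = (Submodule.prodEquivOfIsCompl _ _ h').conj
      ((p.toRepresentation g).prodMap (q.toRepresentation g)) := by
    rw [LinearEquiv.conj_apply, LinearEquiv.eq_comp_toLinearMap_symm]
    ext x <;> simp [Subrepresentation.toRepresentation]
  rw [character, hconj, LinearMap.trace_conj', LinearMap.trace_prodMap']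
  rfl

theorem character_eq_ker_add_range [Finite G] {ρ : Representation ℚ G V} {σ : Representation ℚ G W}
    (f : IntertwiningMap ρ σ) (g : G) :
    ρ.character g = f.ker.toRepresentation.character g + f.range.toRepresentation.character g := by
  obtain ⟨q, hq⟩ := exists_isCompl f.ker
  rw [character_eq_add_of_isCompl ρ hq]
  congr 1
  let F : IntertwiningMap q.toRepresentation f.range.toRepresentation :=
    ⟨f.toLinearMap.restrict (p := q.toSubmodule) (q := f.range.toSubmodule)
      (fun x _ => ⟨x, rfl⟩), by
        intro g; ext x
        exact IntertwiningMap.isIntertwining _ _ f g x⟩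
  have hF : Function.Bijective F := by
    constructor
    · rw [injective_iff_map_eq_zero]
      rintro ⟨x, hx⟩ h0
      have : x ∈ f.ker ⊓ q := ⟨congrArg Subtype.val h0, hx⟩
      rw [disjoint_iff.mp hq.1] at this
      exact Subtype.ext this
    · rintro ⟨_, x, rfl⟩
      have hx : x ∈ f.ker ⊔ q := by rw [codisjoint_iff.mp hq.2]; trivial
      obtain ⟨y, hy, z, hz, rfl⟩ := Submodule.mem_sup.mp hx
      refine ⟨⟨z, hz⟩, Subtype.ext ?_⟩
      have hy' : f.toLinearMap y = 0 := hy
      change f.toLinearMap z = f.toLinearMap (y + z)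
      rw [map_add, hy', zero_add]
  exact congrFun (char_iso (F.ofBijective hF)) g

theorem sum_character_comp_nonneg {H : Type} [Group H] [Fintype H] (ι : H →* G)
    (ρ : Representation ℚ G V) : 0 ≤ ∑ h, ρ.character (ι h) := by
  have hH : (Nat.card H : ℚ) ≠ 0 := Nat.cast_ne_zero.mpr Nat.card_pos.ne'
  let _ : Invertible (Nat.card H : ℚ) := invertibleOfNonzero hH
  have := card_inv_mul_sum_char_eq_finrank (ρ.comp ι)
  have h2 : ∑ h, ρ.character (ι h) = ∑ h, character (ρ.comp ι) h := rfl
  rw [h2, ← mul_inv_cancel_left₀ hH (∑ h, _), this]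
  positivity

end Representation

open Representation Module in
/-- If the difference of two rational characters has norm one and positive degree, then it is
itself a character, so that its average over any subgroup is nonnegative. -/
theorem sum_character_sub_nonneg {G H : Type} [Group G] [Fintype G] [Group H] [Fintype H]
    (ι : H →* G) {V W : Type} [AddCommGroup V] [Module ℚ V] [FiniteDimensional ℚ V]
    [AddCommGroup W] [Module ℚ W] [FiniteDimensional ℚ W]
    (ρ : Representation ℚ G V) (σ : Representation ℚ G W)
    (hnorm : ∑ g, (ρ.character g - σ.character g) * (ρ.character g⁻¹ - σ.character g⁻¹) =
      Nat.card G)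
    (hpos : 0 < ρ.character 1 - σ.character 1) :
    0 ≤ ∑ h, (ρ.character (ι h) - σ.character (ι h)) := by
  induction hd : finrank ℚ V + finrank ℚ W using Nat.strong_induction_on generalizing V W with
  | _ d ih =>
  have hG : (Nat.card G : ℚ) ≠ 0 := Nat.cast_ne_zero.mpr Nat.card_pos.ne'
  let _ : Invertible (Nat.card G : ℚ) := invertibleOfNonzero hG
  by_cases hf : ∃ f : IntertwiningMap ρ σ, f ≠ 0
  · obtain ⟨f, hf⟩ := hf
    obtain ⟨q, hq⟩ := exists_isCompl f.range
    have key : ∀ g, ρ.character g - σ.character g =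
        f.ker.toRepresentation.character g - q.toRepresentation.character g := by
      intro g
      rw [character_eq_ker_add_range f g, character_eq_add_of_isCompl σ hq g]; ring
    have hr : 0 < finrank ℚ f.range.toSubmodule := by
      rw [Nat.pos_iff_ne_zero, ne_eq, Submodule.finrank_eq_zero]
      intro h0
      apply hf
      ext x
      exact LinearMap.congr_fun (LinearMap.range_eq_bot.mp h0) x
    have h1 := character_eq_ker_add_range f 1
    have h2 := character_eq_add_of_isCompl σ hq 1
    simp only [char_one] at h1 h2
    norm_cast at h1 h2
    simp only [key] at hnorm hpos ⊢
    exact ih _ (by omega) _ _ hnorm hpos rfl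
  · push Not at hf
    have e1 := card_inv_mul_sum_char_mul_char_eq_finrank ρ σ
    have e2 := card_inv_mul_sum_char_mul_char_eq_finrank ρ ρ
    have e3 := card_inv_mul_sum_char_mul_char_eq_finrank σ σ
    have hsub : Subsingleton (IntertwiningMap ρ σ) := ⟨fun a b => by rw [hf a, hf b]⟩
    rw [finrank_zero_of_subsingleton] at e1
    have e4 : ∑ g, ρ.character g * σ.character g⁻¹ = ∑ g, σ.character g * ρ.character g⁻¹ := by
      rw [← Equiv.sum_comp (Equiv.inv G)]
      simp [mul_comm]
    have hsum : (finrank ℚ (IntertwiningMap ρ ρ) : ℚ) + finrank ℚ (IntertwiningMap σ σ) = 1 := by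
      have h1 := inv_mul_cancel₀ hG
      nth_rw 2 [← hnorm] at h1
      simp only [sub_mul, mul_sub, Finset.sum_sub_distrib, e4] at h1
      rw [← e2, ← e3]
      push_cast at e1
      linear_combination h1 + 2 * e1
    norm_cast at hsum
    have hσ : finrank ℚ (IntertwiningMap σ σ) = 0 := by
      by_contra hne
      have hρ : finrank ℚ (IntertwiningMap ρ ρ) = 0 := by omega
      have : Subsingleton (IntertwiningMap ρ ρ) := finrank_zero_iff.mp hρ
      have hV : Subsingleton V := ⟨fun a b => by
        have h := Subsingleton.elim (IntertwiningMap.id ρ) 0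
        have ha := DFunLike.congr_fun h a
        have hb := DFunLike.congr_fun h b
        simp at ha hb
        rw [ha, hb]⟩
      rw [char_one, char_one, finrank_zero_of_subsingleton] at hpos
      have : (0 : ℚ) ≤ finrank ℚ W := by positivity
      simp at hpos
      linarith
    have : Subsingleton (IntertwiningMap σ σ) := finrank_zero_iff.mp hσ
    have hW : Subsingleton W := ⟨fun a b => by
        have h := Subsingleton.elim (IntertwiningMap.id σ) 0
        have ha := DFunLike.congr_fun h a
        have hb := DFunLike.congr_fun h b
        simp at ha hb
        rw [ha, hb]⟩
    have hc : ∀ g, σ.character g = 0 := fun g => by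
      rw [character, Subsingleton.elim (σ g) 0, map_zero]
    simp only [hc, sub_zero]
    exact sum_character_comp_nonneg ι ρ

/-- The linear representation attached to an action on a finite set. -/
def permRep {G X : Type} [Group G] (φ : G →* Equiv.Perm X) : Representation ℚ G (X → ℚ) where
  toFun g := LinearMap.funLeft ℚ ℚ (φ g⁻¹)
  map_one' := by ext; simp
  map_mul' g h := by ext; simp [LinearMap.funLeft]

theorem permRep_character {G X : Type} [Group G] [Fintype X] [DecidableEq X]
    (φ : G →* Equiv.Perm X) (g : G) :
    (permRep φ).character g = Fintype.card {x // φ g x = x} := by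
  rw [Representation.character, LinearMap.trace_eq_matrix_trace ℚ (Pi.basisFun ℚ X),
    Matrix.trace, Fintype.card_subtype, Finset.card_filter]
  push_cast
  refine Finset.sum_congr rfl fun x _ => ?_
  have : (φ g).symm x = x ↔ φ g x = x := by rw [Equiv.symm_apply_eq, eq_comm]
  simp [permRep, LinearMap.funLeft, Pi.single_apply, this]

theorem sum_card_fixed_sub_nonneg {G H X Y : Type} [Group G] [Fintype G] [Group H] [Fintype H]
    [Fintype X] [DecidableEq X] [Fintype Y] [DecidableEq Y]
    (ι : H →* G) (φ : G →* Equiv.Perm X) (ψ : G →* Equiv.Perm Y) (χ : G → ℚ)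
    (hχ : ∀ g, χ g = (Fintype.card {x // φ g x = x} : ℚ) - Fintype.card {y // ψ g y = y})
    (hnorm : ∑ g, χ g * χ g = Nat.card G) (hpos : 0 < χ 1) :
    0 ≤ ∑ h, χ (ι h) := by
  have hinv : ∀ g, χ g⁻¹ = χ g := fun g => by
    simp only [hχ, map_inv, Equiv.Perm.inv_eq_iff_eq]
    simp only [eq_comm]
  have hχ' : ∀ g, χ g = (permRep φ).character g - (permRep ψ).character g := fun g => by
    rw [hχ, permRep_character, permRep_character]
  have := sum_character_sub_nonneg ι (permRep φ) (permRep ψ)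
  simp only [← hχ', hinv] at this
  exact this hnorm hpos

namespace Foulkes

/-- The complete homogeneous symmetric functions in power sums, with integer index. -/
noncomputable def hP (z : ℤ) : MvPolynomial ℕ ℚ := if 0 ≤ z then hInP z.toNat else 0

theorem hP_natCast (n : ℕ) : hP n = hInP n := by simp [hP]

theorem hP_of_neg {z : ℤ} (hz : z < 0) : hP z = 0 := if_neg (not_le.mpr hz)

theorem hInP_zero : hInP 0 = 1 := by rw [hInP]

theorem hP_zero : hP 0 = 1 := by simp [hP, hInP_zero]

theorem hInP_succ (n : ℕ) :
    ((n : ℚ) + 1) • hInP (n + 1) = ∑ i ∈ Finset.range (n + 1), X i * hInP (n - i) := by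
  rw [hInP, smul_inv_smul₀ (by positivity)]

theorem hInP_one : hInP 1 = X 0 := by
  have := hInP_succ 0
  simpa [hInP_zero] using this

theorem hP_one : hP 1 = X 0 := by simp [hP, hInP_one]

theorem toP_hh (n : ℕ) : toP (hh n) = hInP n := by
  cases n with
  | zero => simp [hh, hInP_zero]
  | succ n => simp [hh, toP]

theorem toP_hZ (z : ℤ) : toP (hZ z) = hP z := by
  unfold hZ hP
  split_ifs <;> simp [toP_hh]

theorem toP_pSym (n : ℕ) : toP (pSym (n + 1)) = X n := by
  induction n using Nat.strong_induction_on with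
  | _ n ih =>
    rw [pSym, map_sub, map_sum, map_smul, toP_hh, hInP_succ, Finset.sum_range_succ,
      ← Finset.sum_attach (Finset.range n)]
    simp only [map_mul, toP_hh, fun i : Finset.range n => ih i.1 (Finset.mem_range.mp i.2)]
    simp [hInP_zero]

/-- The Hall inner product in the power sum basis. -/
noncomputable def hallP : MvPolynomial ℕ ℚ →ₗ[ℚ] MvPolynomial ℕ ℚ →ₗ[ℚ] ℚ :=
  (basisMonomials ℕ ℚ).constr ℚ fun d => zQ d • lcoeff ℚ d

theorem hallP_monomial (d : ℕ →₀ ℕ) (a : ℚ) (g : MvPolynomial ℕ ℚ) :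
    hallP (monomial d a) g = zQ d * a * coeff d g := by
  have h : monomial d a = a • basisMonomials ℕ ℚ d := by
    rw [coe_basisMonomials, smul_monomial, smul_eq_mul, mul_one]
  rw [h, hallP, map_smul, Module.Basis.constr_basis]
  simp
  ring

theorem hall_eq (f g : SymF) : hall f g = hallP (toP f) (toP g) := by
  conv_rhs => rw [(toP f).as_sum, map_sum, LinearMap.sum_apply]
  simp only [hallP_monomial]
  rfl

theorem zQ_add_single (d : ℕ →₀ ℕ) (k : ℕ) :
    zQ (d + Finsupp.single k 1) = (k + 1) * (d k + 1) * zQ d := by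
  have h0 : ∀ i, (fun i m : ℕ => ((i : ℚ) + 1) ^ m * (Nat.factorial m : ℚ)) i 0 = 1 := by simp
  unfold zQ
  rw [← Finsupp.mul_prod_erase' d k _ h0, ← Finsupp.mul_prod_erase' (d + _) k _ h0]
  have he : (d + Finsupp.single k 1).erase k = d.erase k := by
    ext i
    by_cases h : i = k <;> simp [Finsupp.erase, h]
  rw [he]
  simp only [Finsupp.add_apply, Finsupp.single_eq_same, Nat.factorial_succ, pow_succ]
  push_cast
  ring

/-- The derivation adjoint to multiplication by the power sum `p_{k+1}`. -/
noncomputable def dP (k : ℕ) : Derivation ℚ (MvPolynomial ℕ ℚ) (MvPolynomial ℕ ℚ) :=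
  ((k : ℚ) + 1) • pderiv k

theorem dP_X (k i : ℕ) : dP k (X i) = if i = k then (C ((k : ℚ) + 1)) else 0 := by
  simp only [dP, Derivation.smul_apply, pderiv_X, Pi.single_apply]
  split_ifs <;> simp [smul_eq_C_mul]

theorem hallP_X_mul (k : ℕ) (f g : MvPolynomial ℕ ℚ) :
    hallP (X k * f) g = hallP f (dP k g) := by
  induction f using MvPolynomial.induction_on' with
  | add p q hp hq => simp [mul_add, hp, hq]
  | monomial d a =>
    rw [X, monomial_mul, add_comm, hallP_monomial, hallP_monomial, zQ_add_single]
    simp [dP, coeff_pderiv]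
    ring

theorem dP_hInP (k n : ℕ) : dP k (hInP n) = if k < n then hInP (n - (k + 1)) else 0 := by
  induction n using Nat.strong_induction_on with
  | _ n ih =>
    cases n with
    | zero => simp [hInP_zero]
    | succ n =>
      have hn : ((n : ℚ) + 1) ≠ 0 := by positivity
      refine (smul_right_injective _ hn) ?_
      change ((n : ℚ) + 1) • dP k _ = ((n : ℚ) + 1) • _
      rw [← Derivation.map_smul, hInP_succ]
      simp only [map_sum, Derivation.leibniz, smul_eq_mul, dP_X]
      rw [Finset.sum_add_distrib, Finset.sum_congr rfl fun i hi => by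
        rw [ih (n - i) (by omega)]]
      simp only [mul_ite, mul_zero, Finset.sum_ite_eq', Finset.mem_range, ← Finset.sum_filter]
      split_ifs with hk
      · obtain ⟨m, rfl⟩ := Nat.exists_eq_add_of_le (Nat.lt_succ_iff.mp hk)
        have hf : (Finset.range (k + m + 1)).filter (fun i => k < k + m - i) = Finset.range m := by
          ext i; simp; omega
        have hm : ∑ i ∈ Finset.range m, X i * hInP (k + m - i - (k + 1)) =
            (m : ℚ) • hInP m := by
          cases m with
          | zero => simp
          | succ m =>
            push_cast
            rw [hInP_succ]
            refine Finset.sum_congr rfl fun i hi => ?_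
            congr 2; omega
        rw [hf, hm, show k + m + 1 - (k + 1) = m by omega, show k + m - k = m by omega,
          mul_comm, ← smul_eq_C_mul, ← add_smul]
        congr 1; push_cast; ring
      · rw [Finset.filter_false_of_mem (by intro i; omega)]
        simp

theorem dP_hP (k : ℕ) (z : ℤ) : dP k (hP z) = hP (z - (k + 1)) := by
  unfold hP
  by_cases hz : 0 ≤ z
  · lift z to ℕ using hz
    simp only [Nat.cast_nonneg, if_true, Int.toNat_natCast, dP_hInP]
    by_cases h : k < z
    · rw [if_pos h, if_pos (by omega)]; congr 1; omega
    · rw [if_neg h, if_neg (by omega)]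
  · rw [if_neg hz, if_neg (by omega), map_zero]

theorem derivation_prod {R A ι : Type*} [CommSemiring R] [CommSemiring A] [Algebra R A]
    [DecidableEq ι] (D : Derivation R A A) (s : Finset ι) (f : ι → A) :
    D (∏ i ∈ s, f i) = ∑ i ∈ s, D (f i) * ∏ j ∈ s.erase i, f j := by
  induction s using Finset.induction_on with
  | empty => simp
  | insert a s ha ih =>
    rw [Finset.prod_insert ha, Derivation.leibniz, ih, Finset.sum_insert ha,
      Finset.erase_insert ha, smul_eq_mul, smul_eq_mul, Finset.mul_sum, add_comm, mul_comm (D _)]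
    congr 1
    refine Finset.sum_congr rfl fun i hi => ?_
    rw [Finset.erase_insert_of_ne (by rintro rfl; exact ha hi),
      Finset.prod_insert (fun h => ha (Finset.mem_of_mem_erase h)), mul_left_comm]

theorem derivation_prod_univ {R A ι : Type*} [CommSemiring R] [CommSemiring A] [Algebra R A]
    [Fintype ι] [DecidableEq ι] (D : Derivation R A A) (f : ι → A) :
    D (∏ i, f i) = ∑ i, ∏ j, Function.update f i (D (f i)) j := by
  rw [derivation_prod]
  refine Finset.sum_congr rfl fun i _ => ?_
  rw [Finset.prod_update_of_mem (Finset.mem_univ i), Finset.sdiff_singleton_eq_erase]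

theorem derivation_det {R A ι : Type*} [CommRing R] [CommRing A] [Algebra R A]
    [Fintype ι] [DecidableEq ι] (D : Derivation R A A) (M : Matrix ι ι A) :
    D M.det = ∑ i, (M.updateRow i fun j => D (M i j)).det := by
  simp only [← Matrix.det_transpose M, ← Matrix.det_transpose (M.updateRow _ _)]
  simp only [Matrix.det_apply, map_sum, Units.smul_def, map_zsmul, derivation_prod_univ,
    Finset.smul_sum]
  rw [Finset.sum_comm]
  refine Finset.sum_congr rfl fun i _ => Finset.sum_congr rfl fun σ _ => ?_
  congr 1
  refine Finset.prod_congr rfl fun j _ => ?_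
  by_cases h : j = i <;> simp [h, Matrix.updateRow_apply, Function.update_apply]

/-- The Jacobi-Trudi determinant whose `i`-th row consists of the `h_{r i + j}`. -/
noncomputable def sch {N : ℕ} (r : Fin N → ℤ) : MvPolynomial ℕ ℚ :=
  (Matrix.of fun i j : Fin N => hP (r i + j)).det

theorem dP_sch {N : ℕ} (k : ℕ) (r : Fin N → ℤ) :
    dP k (sch r) = ∑ i, sch (Function.update r i (r i - (k + 1))) := by
  rw [sch, derivation_det]
  refine Finset.sum_congr rfl fun i _ => congrArg Matrix.det ?_
  ext a b
  by_cases h : a = i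
  · subst h; simp [dP_hP, add_sub_right_comm]
  · simp [h, Matrix.updateRow_apply]

theorem toP_schur (l : List ℕ) :
    toP (schur l) = sch fun i : Fin l.length => (l.get i : ℤ) - i := by
  rw [schur, ← AlgHom.coe_toRingHom, RingHom.map_det, sch]
  congr 1
  ext i j
  simp [toP_hZ, add_sub_right_comm]

/-- Evaluation of power sums at a finite family of weights. -/
noncomputable def pw {Y R : Type*} [Fintype Y] [CommRing R] [Algebra ℚ R] (w : Y → R) :
    MvPolynomial ℕ ℚ →ₐ[ℚ] R :=
  aeval fun k => ∑ y, w y ^ (k + 1)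

theorem pw_X {Y R : Type*} [Fintype Y] [CommRing R] [Algebra ℚ R] (w : Y → R) (k : ℕ) :
    pw w (X k) = ∑ y, w y ^ (k + 1) := by simp [pw]

/-- The coefficient functional for integer exponent vectors. -/
noncomputable def cz {N : ℕ} (μ : Fin N → ℤ) : MvPolynomial (Fin N) ℚ →ₗ[ℚ] ℚ :=
  if ∀ i, 0 ≤ μ i then lcoeff ℚ (Finsupp.equivFunOnFinite.symm fun i => (μ i).toNat) else 0

theorem cz_monomial {N : ℕ} (μ : Fin N → ℤ) (e : Fin N →₀ ℕ) (a : ℚ) :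
    cz μ (monomial e a) = if ∀ i, μ i = e i then a else 0 := by
  unfold cz
  split_ifs with h1 h2 h2
  · have : (Finsupp.equivFunOnFinite.symm fun i => (μ i).toNat) = e := by
      ext i; simp [h2]
    simp [this]
  · have : e ≠ (Finsupp.equivFunOnFinite.symm fun i => (μ i).toNat) := by
      rintro rfl
      exact h2 fun i => by simp [h1 i]
    simp [coeff_monomial, this]
  · exact absurd (fun i => by rw [h2 i]; positivity) h1
  · rfl

theorem cz_X_pow_mul {N : ℕ} (μ : Fin N → ℤ) (i : Fin N) (k : ℕ) (f : MvPolynomial (Fin N) ℚ) :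
    cz μ (X i ^ k * f) = cz (Function.update μ i (μ i - k)) f := by
  induction f using MvPolynomial.induction_on' with
  | add p q hp hq => simp [mul_add, hp, hq]
  | monomial e a =>
    rw [X_pow_eq_monomial, monomial_mul, one_mul, cz_monomial, cz_monomial]
    congr 1
    refine propext (forall_congr' fun j => ?_)
    by_cases h : j = i
    · subst h; simp; omega
    · simp [h]

theorem constantCoeff_hP (z : ℤ) : constantCoeff (hP z) = if z = 0 then 1 else 0 := by
  rcases lt_trichotomy z 0 with h | rfl | h
  · rw [hP_of_neg h, if_neg h.ne, map_zero]
  · simp [hP_zero]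
  · rw [if_neg h.ne']
    obtain ⟨n, rfl⟩ : ∃ n : ℕ, z = (n + 1 : ℕ) := ⟨(z - 1).toNat, by omega⟩
    have := congrArg constantCoeff (hInP_succ n)
    rw [hP_natCast]
    simpa [constantCoeff_smul, Nat.cast_add_one_ne_zero] using this

/-- The complete homogeneous functions are dual to the monomials. -/
theorem hallP_prod_hP {N : ℕ} (f : MvPolynomial ℕ ℚ) (μ : Fin N → ℤ) :
    hallP f (∏ i, hP (μ i)) = cz μ (pw X f) := by
  induction f using MvPolynomial.induction_on generalizing μ with
  | C a =>
    have h : coeff 0 (∏ i, hP (μ i)) = ∏ i, constantCoeff (hP (μ i)) := by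
      rw [← constantCoeff_eq, map_prod]
    have hC : (algebraMap ℚ (MvPolynomial (Fin N) ℚ)) a = monomial 0 a := rfl
    rw [C_apply, hallP_monomial, h, ← C_apply, ← algebraMap_eq, AlgHom.commutes, hC, cz_monomial]
    simp only [constantCoeff_hP, Finset.prod_ite_zero]
    simp [zQ]
  | add p q hp hq => simp [hp, hq]
  | mul_X p k hp =>
    rw [mul_comm, hallP_X_mul, derivation_prod_univ, map_mul, pw_X, Finset.sum_mul, map_sum,
      map_sum]
    refine Finset.sum_congr rfl fun i _ => ?_
    rw [cz_X_pow_mul, ← hp]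
    congr 1
    refine Finset.prod_congr rfl fun j _ => ?_
    by_cases h : j = i
    · subst h; simp [dP_hP]
    · simp [h]

theorem sch_eq_sum {N : ℕ} (r : Fin N → ℤ) :
    sch r = ∑ w : Equiv.Perm (Fin N), (Equiv.Perm.sign w : ℤ) • ∏ i, hP (r i + (w i : ℕ)) := by
  rw [sch, ← Matrix.det_transpose, Matrix.det_apply]
  rfl

/-- The alternating coefficient functional computing inner products with Schur functions. -/
noncomputable def altCoeff {N : ℕ} (r : Fin N → ℤ) : MvPolynomial (Fin N) ℚ →ₗ[ℚ] ℚ :=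
  ∑ w : Equiv.Perm (Fin N), (Equiv.Perm.sign w : ℤ) • cz fun i => r i + (w i : ℕ)

theorem hallP_sch {N : ℕ} (f : MvPolynomial ℕ ℚ) (r : Fin N → ℤ) :
    hallP f (sch r) = altCoeff r (pw X f) := by
  rw [sch_eq_sum, map_sum, altCoeff, LinearMap.sum_apply]
  refine Finset.sum_congr rfl fun w _ => ?_
  rw [map_zsmul, hallP_prod_hP, LinearMap.smul_apply]

section Series

open PowerSeries (derivative)

variable {Y R : Type*} [Fintype Y] [CommRing R]

theorem mk_pow_mul_one_sub (a : R) :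
    (PowerSeries.mk fun n => a ^ n) * (1 - PowerSeries.C a * PowerSeries.X) = 1 := by
  ext n
  rw [mul_sub, mul_one, mul_left_comm, map_sub, PowerSeries.coeff_C_mul]
  cases n with
  | zero => simp
  | succ n => simp [PowerSeries.coeff_succ_mul_X, pow_succ', PowerSeries.coeff_one]

variable [Algebra ℚ R]

/-- The generating series of the complete homogeneous functions at the weights `w`. -/
noncomputable def hSeries (w : Y → R) : PowerSeries R := PowerSeries.mk fun n => pw w (hInP n)

theorem derivative_hSeries (w : Y → R) :
    derivative R (hSeries w) = (PowerSeries.mk fun n => pw w (X n)) * hSeries w := by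
  ext n
  rw [PowerSeries.coeff_derivative, PowerSeries.coeff_mul,
    Finset.Nat.sum_antidiagonal_eq_sum_range_succ_mk]
  have := congrArg (pw w) (hInP_succ n)
  rw [map_smul, map_sum, Algebra.smul_def] at this
  simp only [map_mul, map_add, map_natCast, map_one] at this
  simpa [hSeries, mul_comm] using this

/-- The generating series `∑ hₙ tⁿ` is inverse to `∏ (1 - w_y t)`. -/
theorem hSeries_mul_prod (w : Y → R) :
    hSeries w * ∏ y, (1 - PowerSeries.C (w y) * PowerSeries.X) = 1 := by
  classical
  have : IsAddTorsionFree R := IsAddTorsionFree.of_module_rat R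
  refine PowerSeries.derivative.ext ?_ ?_
  · rw [Derivation.leibniz, derivative_hSeries, derivation_prod, PowerSeries.derivative_one,
      smul_eq_mul, smul_eq_mul]
    have hg : (PowerSeries.mk fun n => pw w (X n)) =
        ∑ y, PowerSeries.C (w y) * PowerSeries.mk fun n => w y ^ n := by
      ext n
      simp [pw_X, map_sum, pow_succ']
    have hE : (PowerSeries.mk fun n => pw w (X n)) *
        (∏ y, (1 - PowerSeries.C (w y) * PowerSeries.X)) =
        ∑ y, PowerSeries.C (w y) *
          ∏ z ∈ Finset.univ.erase y, (1 - PowerSeries.C (w z) * PowerSeries.X) := by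
      rw [hg, Finset.sum_mul]
      refine Finset.sum_congr rfl fun y _ => ?_
      rw [← Finset.mul_prod_erase _ _ (Finset.mem_univ y), mul_assoc,
        ← mul_assoc (PowerSeries.mk _),
        mk_pow_mul_one_sub, one_mul]
    have hd : ∀ y, derivative R (1 - PowerSeries.C (w y) * PowerSeries.X) =
        - PowerSeries.C (w y) := fun y => by
      simp [map_sub, Derivation.leibniz]
    simp only [hd, neg_mul, Finset.sum_neg_distrib, ← hE]
    ring
  · simp [hSeries, hInP_zero, map_prod]

theorem hSeries_eq_prod (w : Y → R) : hSeries w = ∏ y, PowerSeries.mk fun n => w y ^ n := by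
  have h : (∏ y, PowerSeries.mk fun n => w y ^ n) *
      ∏ y, (1 - PowerSeries.C (w y) * PowerSeries.X) = 1 := by
    rw [← Finset.prod_mul_distrib]
    exact Finset.prod_eq_one fun y _ => mk_pow_mul_one_sub _
  rw [← mul_one (hSeries w), ← h, mul_left_comm, hSeries_mul_prod, mul_one]

theorem pw_hInP [DecidableEq Y] (w : Y → R) (n : ℕ) :
    pw w (hInP n) = ∑ c ∈ Finset.univ.piAntidiag n, ∏ y, w y ^ c y := by
  have : pw w (hInP n) = PowerSeries.coeff n (hSeries w) := by simp [hSeries]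
  rw [this, hSeries_eq_prod, PowerSeries.coeff_prod]
  refine Finset.sum_nbij (fun l => ⇑l) (fun l hl => ?_) (DFunLike.coe_injective.injOn)
    (fun c hc => ⟨Finsupp.equivFunOnFinite.symm c, ?_, rfl⟩) (fun l _ => by simp)
  · simpa using hl
  · simpa using hc

end Series

section Alternant

variable {Y R : Type*} [CommRing R]

theorem coeff_prod_one_sub_eq_zero (w : Y → R) (s : Finset Y) (b : ℕ) (hb : s.card < b) :
    PowerSeries.coeff b (∏ y ∈ s, (1 - PowerSeries.C (w y) * PowerSeries.X)) = 0 := by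
  classical
  induction s using Finset.induction_on generalizing b with
  | empty => simp [PowerSeries.coeff_one]; simp at hb; omega
  | insert a s ha ih =>
    rw [Finset.card_insert_of_notMem ha] at hb
    obtain ⟨b, rfl⟩ := Nat.exists_eq_succ_of_ne_zero (by omega : b ≠ 0)
    rw [Finset.prod_insert ha, sub_mul, one_mul, map_sub, mul_assoc, PowerSeries.coeff_C_mul,
      Nat.succ_eq_add_one, PowerSeries.coeff_succ_X_mul, ih _ (by omega), ih _ (by omega)]
    simp

variable [Fintype Y] [Algebra ℚ R]

theorem sum_pw_hP_mul_coeff (w : Y → R) {N : ℕ} (F : PowerSeries R)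
    (hF : ∀ b, N ≤ b → PowerSeries.coeff b F = 0) (m : ℕ) :
    ∑ j : Fin N, pw w (hP ((m : ℤ) - ((N : ℤ) - 1) + j)) * PowerSeries.coeff (N - 1 - j) F =
      PowerSeries.coeff m (hSeries w * F) := by
  set g : ℕ → R := fun b => pw w (hP ((m : ℤ) - b)) * PowerSeries.coeff b F with hg
  have h1 : ∑ j : Fin N, pw w (hP ((m : ℤ) - ((N : ℤ) - 1) + j)) *
      PowerSeries.coeff (N - 1 - j) F = ∑ b ∈ Finset.range N, g b := by
    rw [← Finset.sum_range_reflect, ← Fin.sum_univ_eq_sum_range (fun j => g (N - 1 - j))]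
    refine Finset.sum_congr rfl fun j _ => ?_
    simp only [hg]
    congr 3
    have := j.2
    omega
  have h2 : PowerSeries.coeff m (hSeries w * F) = ∑ b ∈ Finset.range (m + 1), g b := by
    rw [mul_comm, PowerSeries.coeff_mul, Finset.Nat.sum_antidiagonal_eq_sum_range_succ_mk]
    refine Finset.sum_congr rfl fun b hb => ?_
    have hb' : b ≤ m := Nat.lt_succ_iff.mp (Finset.mem_range.mp hb)
    simp only [hg, hSeries, PowerSeries.coeff_mk]
    rw [mul_comm, ← Nat.cast_sub hb', hP_natCast]
  rw [h1, h2, Finset.sum_subset (Finset.range_subset_range.mpr (by omega : N ≤ N + m + 1)),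
    Finset.sum_subset (Finset.range_subset_range.mpr (by omega : m + 1 ≤ N + m + 1))]
  · intro b _ hb
    rw [Finset.mem_range, not_lt] at hb
    simp only [hg]
    rw [hP_of_neg (by omega), map_zero, zero_mul]
  · intro b _ hb
    rw [Finset.mem_range, not_lt] at hb
    simp only [hg]
    rw [hF b hb, mul_zero]

/-- A Schur function with more parts than variables vanishes. -/
theorem pw_sch_eq_zero [IsDomain R] (w : Y → R) {N : ℕ} (hN : Fintype.card Y < N)
    (r : Fin N → ℤ) (hr : ∀ i, 1 ≤ r i + (N - 1)) : pw w (sch r) = 0 := by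
  classical
  rw [sch, ← AlgHom.coe_toRingHom, RingHom.map_det, ← Matrix.exists_mulVec_eq_zero_iff]
  set F := ∏ y, (1 - PowerSeries.C (w y) * PowerSeries.X)
  refine ⟨fun j => PowerSeries.coeff (N - 1 - j) F, fun h => ?_, funext fun i => ?_⟩
  · have := congrFun h ⟨N - 1, by omega⟩
    simp [F, map_prod] at this
  · have := sum_pw_hP_mul_coeff w (N := N) F
      (fun b hb => coeff_prod_one_sub_eq_zero w _ b (by simpa using by omega))
      (r i + (N - 1)).toNat
    rw [hSeries_mul_prod, PowerSeries.coeff_one, if_neg (by have := hr i; omega),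
      Int.toNat_of_nonneg (by have := hr i; omega), add_sub_cancel_right] at this
    simpa [Matrix.mulVec, dotProduct] using this

theorem sch_neg_eq_one {N : ℕ} : sch (fun i : Fin N => -(i : ℤ)) = 1 := by
  rw [sch, Matrix.det_of_isUpperTriangular]
  · simp [hP_zero]
  · intro i j hij
    simp only [id] at hij
    exact hP_of_neg (by have : (j : ℕ) < i := hij; omega)

/-- The bialternant formula. -/
theorem det_X_pow_eq {N : ℕ} (ρ : Fin N → ℕ) :
    (Matrix.of fun i k : Fin N => (X k : MvPolynomial (Fin N) ℚ) ^ ρ i).det =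
      pw X (sch fun i => (ρ i : ℤ) - ((N : ℤ) - 1)) *
        (Matrix.of fun i k : Fin N => (X k : MvPolynomial (Fin N) ℚ) ^ (N - 1 - (i : ℕ))).det := by
  set F : Fin N → PowerSeries (MvPolynomial (Fin N) ℚ) := fun k =>
    ∏ l ∈ Finset.univ.erase k, (1 - PowerSeries.C (X l) * PowerSeries.X)
  set E : Matrix (Fin N) (Fin N) (MvPolynomial (Fin N) ℚ) :=
    Matrix.of fun j k => PowerSeries.coeff (N - 1 - j) (F k)
  have hF : ∀ k, hSeries X * F k = PowerSeries.mk fun n => (X k : MvPolynomial (Fin N) ℚ) ^ n :=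
    fun k => by
      rw [← mul_one (hSeries X * F k), ← mk_pow_mul_one_sub (X k : MvPolynomial (Fin N) ℚ),
        mul_left_comm, mul_assoc, Finset.prod_erase_mul _ _ (Finset.mem_univ k), hSeries_mul_prod,
        mul_one]
  have key : ∀ ρ : Fin N → ℕ, (Matrix.of fun i k : Fin N => (X k : MvPolynomial (Fin N) ℚ) ^ ρ i) =
      (pw X).toRingHom.mapMatrix (Matrix.of fun i j : Fin N =>
        hP ((ρ i : ℤ) - ((N : ℤ) - 1) + j)) * E := by
    intro ρ
    ext1 i k
    have := sum_pw_hP_mul_coeff X (N := N) (F k) (fun b hb =>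
      coeff_prod_one_sub_eq_zero X _ b (by
        rw [Finset.card_erase_of_mem (Finset.mem_univ k), Finset.card_fin]
        have := k.2
        omega)) (ρ i)
    rw [hF, PowerSeries.coeff_mk] at this
    simp [Matrix.mul_apply, E, this]
  have hdet : ∀ ρ : Fin N → ℕ,
      (Matrix.of fun i k : Fin N => (X k : MvPolynomial (Fin N) ℚ) ^ ρ i).det =
        pw X (sch fun i => (ρ i : ℤ) - ((N : ℤ) - 1)) * E.det := by
    intro ρ
    rw [key, Matrix.det_mul, ← RingHom.map_det]
    rfl
  have h1 : (fun i : Fin N => (((N - 1 - i : ℕ) : ℤ)) - ((N : ℤ) - 1)) =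
      fun i : Fin N => -(i : ℤ) := by
    funext i; have := i.2; omega
  rw [hdet, hdet fun i => N - 1 - i, h1, sch_neg_eq_one, map_one, one_mul]

theorem cz_prod_X_pow_mul {N : ℕ} (μ : Fin N → ℤ) (e : Fin N → ℕ) (f : MvPolynomial (Fin N) ℚ) :
    cz μ ((∏ i, X i ^ e i) * f) = cz (fun i => μ i - e i) f := by
  have he : (∏ i, X i ^ e i : MvPolynomial (Fin N) ℚ) =
      monomial (Finsupp.equivFunOnFinite.symm e) 1 := by
    rw [monomial_eq]; simp [Finsupp.prod_fintype]
  rw [he]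
  induction f using MvPolynomial.induction_on' with
  | add p q hp hq => simp [mul_add, hp, hq]
  | monomial d a =>
    rw [monomial_mul, one_mul, cz_monomial, cz_monomial]
    congr 1
    refine propext (forall_congr' fun j => ?_)
    simp
    omega

theorem altCoeff_eq {N : ℕ} (r : Fin N → ℤ) (f : MvPolynomial (Fin N) ℚ) :
    altCoeff r f = cz (fun i => r i + ((N : ℤ) - 1)) ((Matrix.of fun i k : Fin N =>
      (X k : MvPolynomial (Fin N) ℚ) ^ (N - 1 - (i : ℕ))).det * f) := by
  rw [altCoeff, LinearMap.sum_apply, Matrix.det_apply, Finset.sum_mul, map_sum]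
  refine Finset.sum_congr rfl fun w _ => ?_
  rw [LinearMap.smul_apply, Units.smul_def, smul_mul_assoc, map_zsmul]
  simp only [Matrix.of_apply]
  rw [cz_prod_X_pow_mul]
  congr 3
  funext i
  have := (w i).2
  omega

/-- Schur functions have norm one. -/
theorem hallP_sch_self {N : ℕ} (r : Fin N → ℤ) (hr : StrictAnti r)
    (hr0 : ∀ i, 0 ≤ r i + ((N : ℤ) - 1)) : hallP (sch r) (sch r) = 1 := by
  obtain ⟨ρ, rfl⟩ : ∃ ρ : Fin N → ℕ, r = fun i => (ρ i : ℤ) - ((N : ℤ) - 1) :=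
    ⟨fun i => (r i + (N - 1)).toNat, funext fun i => by have := hr0 i; dsimp only; omega⟩
  have hρ : Function.Injective ρ := fun i j h => hr.injective (by simp [h])
  rw [hallP_sch, altCoeff_eq, mul_comm, ← det_X_pow_eq, Matrix.det_apply, map_sum]
  simp only [Units.smul_def, map_zsmul, Matrix.of_apply, sub_add_cancel]
  have hm : ∀ w : Equiv.Perm (Fin N), cz (fun i => (ρ i : ℤ))
      (∏ i, (X i : MvPolynomial (Fin N) ℚ) ^ ρ (w i)) = if w = 1 then 1 else 0 := by
    intro w
    rw [← mul_one (∏ i, _), cz_prod_X_pow_mul, ← C_1, C_apply, cz_monomial]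
    congr 1
    refine propext ⟨fun h => Equiv.ext fun i => hρ ?_, ?_⟩
    · have := h i
      simp at this ⊢
      omega
    · rintro rfl; simp
  simp [hm]

end Alternant

section Burnside

variable {α Y R : Type*} [Fintype α] [Fintype Y] [DecidableEq Y] [CommRing R]

/-- The sizes of the fibres of a map between finite types. -/
def fibre (f : α → Y) (y : Y) : ℕ := Fintype.card {a // f a = y}

theorem prod_comp_eq (w : Y → R) (f : α → Y) : ∏ a, w (f a) = ∏ y, w y ^ fibre f y := by
  rw [← Fintype.prod_fiberwise' f w]
  simp [fibre]

theorem sum_fibre (f : α → Y) : ∑ y, fibre f y = Fintype.card α := by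
  rw [← Fintype.card_congr (Equiv.sigmaFiberEquiv f), Fintype.card_sigma]
  rfl

variable [DecidableEq α]

theorem card_fibre_eq (c : Y → ℕ) (hc : ∑ y, c y = Fintype.card α) :
    (Finset.univ.filter fun f : α → Y => fibre f = c).card = Nat.multinomial Finset.univ c := by
  have hX : ∀ d : Y → ℕ, (∏ y, X y ^ d y : MvPolynomial Y ℚ) =
      monomial (Finsupp.equivFunOnFinite.symm d) 1 := fun d => by
    rw [monomial_eq]; simp [Finsupp.prod_fintype]
  have h1 : (∑ y, X y : MvPolynomial Y ℚ) ^ Fintype.card α = ∑ f : α → Y, ∏ a, X (f a) := by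
    rw [← Finset.card_univ, ← Finset.prod_const, Finset.prod_univ_sum, Fintype.piFinset_univ]
  rw [Finset.sum_pow_eq_sum_piAntidiag] at h1
  have h2 := congrArg (coeff (Finsupp.equivFunOnFinite.symm c)) h1
  simp only [prod_comp_eq, hX, coeff_sum, coeff_monomial, ← C_eq_coe_nat, coeff_C_mul,
    EmbeddingLike.apply_eq_iff_eq] at h2
  rw [Finset.sum_congr rfl fun d _ => by rw [mul_ite, mul_one, mul_zero], Finset.sum_ite_eq',
    if_pos (by simpa using hc), Finset.sum_boole] at h2
  exact_mod_cast h2.symm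

/-- The permutation character polynomial of the action of a permutation on colourings. -/
def fixSum (w : Y → R) (σ : Equiv.Perm α) : R :=
  ∑ f : α → Y with f ∘ σ = f, ∏ a, w (f a)

variable [Algebra ℚ R]

theorem sum_fixSum (w : Y → R) :
    ∑ σ : Equiv.Perm α, fixSum w σ =
      (Fintype.card α).factorial * pw w (hInP (Fintype.card α)) := by
  simp only [fixSum, Finset.sum_filter]
  rw [Finset.sum_comm]
  have h1 : ∀ f : α → Y, (∑ σ : Equiv.Perm α, if f ∘ σ = f then ∏ a, w (f a) else 0) =
      (∏ y, (fibre f y).factorial : ℕ) * ∏ y, w y ^ fibre f y := by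
    intro f
    rw [← Finset.sum_filter, Finset.sum_const, ← prod_comp_eq, nsmul_eq_mul]
    simp only [fibre]
    rw [← DomMulAct.stabilizer_card, Fintype.card_subtype]
  rw [Finset.sum_congr rfl fun f _ => h1 f, pw_hInP, Finset.mul_sum,
    ← Finset.sum_fiberwise_of_maps_to (t := Finset.univ.piAntidiag (Fintype.card α)) (g := fibre)
      (fun f _ => by simp [sum_fibre])]
  refine Finset.sum_congr rfl fun c hc => ?_
  have hc' : ∑ y, c y = Fintype.card α := by simpa using hc
  rw [Finset.sum_congr rfl fun f hf => by rw [(Finset.mem_filter.mp hf).2], Finset.sum_const,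
    card_fibre_eq c hc', nsmul_eq_mul, ← mul_assoc, ← Nat.cast_mul, mul_comm (Nat.multinomial _ _),
    Nat.multinomial_spec, hc']

end Burnside

section Products

variable {α β Y Z R : Type*} [Fintype α] [DecidableEq α] [Fintype β] [DecidableEq β] [Fintype Y]
  [DecidableEq Y] [Fintype Z] [DecidableEq Z] [CommRing R]

theorem fixSum_mul_fixSum (w : Y → R) (v : Z → R) (σ : Equiv.Perm α) :
    fixSum w σ * fixSum v σ = fixSum (fun p : Y × Z => w p.1 * v p.2) σ := by
  simp only [fixSum]
  rw [Finset.sum_mul_sum, ← Finset.sum_product']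
  refine Finset.sum_bij' (fun p _ a => (p.1 a, p.2 a))
      (fun f _ => (fun a => (f a).1, fun a => (f a).2))
    ?_ ?_ ?_ ?_ ?_
  · rintro ⟨f, g⟩ h
    simp only [Finset.mem_product, Finset.mem_filter, Finset.mem_univ, true_and] at h ⊢
    funext a
    exact Prod.ext (congrFun h.1 a) (congrFun h.2 a)
  · intro f h
    simp only [Finset.mem_product, Finset.mem_filter, Finset.mem_univ, true_and] at h ⊢
    exact ⟨funext fun a => congrArg Prod.fst (congrFun h a),
      funext fun a => congrArg Prod.snd (congrFun h a)⟩
  · intros; rfl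
  · intros; rfl
  · intros; exact Finset.prod_mul_distrib.symm

theorem fixSum_sumCongr (w : Y → R) (σ : Equiv.Perm α) (τ : Equiv.Perm β) :
    fixSum w (Equiv.Perm.sumCongr σ τ) = fixSum w σ * fixSum w τ := by
  simp only [fixSum]
  rw [Finset.sum_mul_sum, ← Finset.sum_product']
  refine Finset.sum_bij' (fun f _ => (f ∘ Sum.inl, f ∘ Sum.inr)) (fun p _ => Sum.elim p.1 p.2)
    ?_ ?_ ?_ ?_ ?_
  · intro f h
    simp only [Finset.mem_product, Finset.mem_filter, Finset.mem_univ, true_and] at h ⊢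
    exact ⟨funext fun a => congrFun h (Sum.inl a), funext fun a => congrFun h (Sum.inr a)⟩
  · rintro ⟨f, g⟩ h
    simp only [Finset.mem_product, Finset.mem_filter, Finset.mem_univ, true_and] at h ⊢
    funext a
    rcases a with a | a
    · exact congrFun h.1 a
    · exact congrFun h.2 a
  · intro f _
    exact Sum.elim_comp_inl_inr f
  · intros; rfl
  · intros; exact Fintype.prod_sum_type _

theorem map_fixSum {S : Type*} [CommRing S] (g : R →+* S) (w : Y → R) (σ : Equiv.Perm α) :
    g (fixSum w σ) = fixSum (fun y => g (w y)) σ := by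
  simp [fixSum, map_sum, map_prod]

theorem fixSum_one (w : Y → R) : fixSum w (1 : Equiv.Perm α) = (∑ y, w y) ^ Fintype.card α := by
  rw [← Finset.card_univ, ← Finset.prod_const, Finset.prod_univ_sum, Fintype.piFinset_univ]
  simp [fixSum]

end Products

theorem pw_mul_X {Y Z R : Type*} [Fintype Y] [Fintype Z] [CommRing R] [Algebra ℚ R]
    (w : Y → R) (v : Z → R) (k : ℕ) :
    pw (fun p : Y × Z => w p.1 * v p.2) (X k) = pw w (X k) * pw v (X k) := by
  simp only [pw_X, Finset.sum_mul_sum, ← Finset.sum_product', mul_pow]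
  rfl

/-- The power sum expansion of the plethysm `hₙ[h₁²]`. -/
noncomputable def foulkesP (n : ℕ) : MvPolynomial ℕ ℚ := aeval (fun i => X i ^ 2) (hInP n)

theorem pw_foulkesP {Y R : Type*} [Fintype Y] [CommRing R] [Algebra ℚ R]
    (w : Y → R) (n : ℕ) : pw w (foulkesP n) = pw (fun p : Y × Y => w p.1 * w p.2) (hInP n) := by
  have : (pw w).comp (aeval fun i => X i ^ 2) = pw (fun p : Y × Y => w p.1 * w p.2) := by
    ext k
    simp only [AlgHom.comp_apply, aeval_X, pw_mul_X, sq, map_mul]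
  exact DFunLike.congr_fun this (hInP n)

section Character

variable {N : ℕ} (r : Fin N → ℤ)

theorem sum_altCoeff_sumCongr (n : ℕ) :
    ∑ σ : Equiv.Perm (Fin n), altCoeff r (fixSum X (Equiv.Perm.sumCongr σ σ)) =
      n.factorial * hallP (foulkesP n) (sch r) := by
  simp only [fixSum_sumCongr, fixSum_mul_fixSum]
  rw [← map_sum, sum_fixSum, hallP_sch, pw_foulkesP, Fintype.card_fin, ← nsmul_eq_mul, map_nsmul,
    nsmul_eq_mul]

open TensorProduct in
theorem sum_altCoeff_sq {α : Type*} [Fintype α] [DecidableEq α] :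
    ∑ σ : Equiv.Perm α, altCoeff r (fixSum X σ) * altCoeff r (fixSum X σ) =
      (Fintype.card α).factorial * ∑ d ∈ (hInP (Fintype.card α)).support,
        coeff d (hInP (Fintype.card α)) * hallP (monomial d 1) (sch r) ^ 2 := by
  let A := MvPolynomial (Fin N) ℚ
  let T : A ⊗[ℚ] A →ₗ[ℚ] ℚ := LinearMap.mul' ℚ ℚ ∘ₗ TensorProduct.map (altCoeff r) (altCoeff r)
  let iL : A →ₐ[ℚ] A ⊗[ℚ] A := Algebra.TensorProduct.includeLeft
  let iR : A →ₐ[ℚ] A ⊗[ℚ] A := Algebra.TensorProduct.includeRight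
  have hT : ∀ a b : A, T (iL a * iR b) = altCoeff r a * altCoeff r b := fun a b => by
    simp [T, iL, iR]
  let W : Fin N × Fin N → A ⊗[ℚ] A := fun p => iL (X p.1) * iR (X p.2)
  have h1 : ∀ σ : Equiv.Perm α, altCoeff r (fixSum X σ) * altCoeff r (fixSum X σ) =
      T (fixSum W σ) := fun σ => by
    rw [← hT, ← AlgHom.coe_toRingHom, ← AlgHom.coe_toRingHom, map_fixSum, map_fixSum,
      fixSum_mul_fixSum]
    rfl
  have h2 : ∀ d : ℕ →₀ ℕ, pw W (monomial d 1) =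
      iL (pw X (monomial d 1)) * iR (pw X (monomial d 1)) := by
    intro d
    have hX : ∀ k, pw W (X k) = iL (pw X (X k)) * iR (pw X (X k)) := fun k => by
      refine (pw_mul_X (fun i => iL (X i)) (fun i => iR (X i)) k).trans ?_
      simp [pw_X]
    simp only [monomial_eq, C_1, one_mul, Finsupp.prod, map_prod, map_pow, hX, mul_pow,
      Finset.prod_mul_distrib]
  rw [Finset.sum_congr rfl fun σ _ => h1 σ, ← map_sum, sum_fixSum, ← nsmul_eq_mul, map_nsmul,
    nsmul_eq_mul]
  congr 1
  conv_lhs => rw [(hInP (Fintype.card α)).as_sum]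
  rw [map_sum, map_sum]
  refine Finset.sum_congr rfl fun d _ => ?_
  have hd : monomial d (coeff d (hInP (Fintype.card α))) =
    coeff d (hInP (Fintype.card α)) • (monomial d 1 : MvPolynomial ℕ ℚ) := by
      rw [smul_monomial, smul_eq_mul, mul_one]
  rw [hd, map_smul, map_smul, h2, hT, ← hallP_sch, smul_eq_mul, sq]

theorem isWeightedHomogeneous_hInP (n : ℕ) :
    IsWeightedHomogeneous (fun k : ℕ => k + 1) (hInP n) n := by
  induction n using Nat.strong_induction_on with
  | _ n ih =>
    cases n with
    | zero => rw [hInP_zero]; exact isWeightedHomogeneous_one _ _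
    | succ n =>
      rw [hInP, smul_eq_C_mul]
      have := (isWeightedHomogeneous_C (fun k : ℕ => k + 1) ((n + 1 : ℚ)⁻¹)).mul
        (IsWeightedHomogeneous.sum (Finset.range (n + 1)) (fun i => X i * hInP (n - i)) (n + 1)
          fun i hi => by
            have hi' := Finset.mem_range.mp hi
            have := (isWeightedHomogeneous_X ℚ (fun k : ℕ => k + 1) i).mul (ih (n - i) (by omega))
            rwa [show i + 1 + (n - i) = n + 1 by omega] at this)
      rwa [zero_add] at this

theorem zQ_mul_coeff_hInP (d : ℕ →₀ ℕ) (n : ℕ) (hd : Finsupp.weight (fun k : ℕ => k + 1) d = n) :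
    zQ d * coeff d (hInP n) = 1 := by
  have h1 := hallP_monomial d 1 (hInP n)
  have h2 := hallP_prod_hP (N := 1) (monomial d 1) fun _ => (n : ℤ)
  rw [Fin.prod_univ_one, hP_natCast, h1, mul_one] at h2
  rw [h2]
  have h3 : pw (X : Fin 1 → MvPolynomial (Fin 1) ℚ) (monomial d (1 : ℚ)) =
      monomial (Finsupp.single 0 n) (1 : ℚ) := by
    simp only [monomial_eq, C_1, one_mul, Finsupp.prod, map_prod, map_pow, pw_X,
      Fin.sum_univ_one, ← pow_mul, Finset.prod_pow_eq_pow_sum]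
    rw [X_pow_eq_monomial, ← hd, Finsupp.weight_apply, Finsupp.sum]
    simp [mul_comm]
  rw [h3, cz_monomial, if_pos (by simp)]

theorem isWeightedHomogeneous_sch (M : ℕ) (hM : ∑ i, (r i + (i : ℕ)) = M) :
    IsWeightedHomogeneous (fun k : ℕ => k + 1) (sch r) M := by
  rw [sch_eq_sum]
  refine IsWeightedHomogeneous.sum _ _ _ fun w _ => ?_
  have key : IsWeightedHomogeneous (fun k : ℕ => k + 1) (∏ i, hP (r i + (w i : ℕ))) M := by
    by_cases h : ∀ i, 0 ≤ r i + (w i : ℕ)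
    · have := IsWeightedHomogeneous.prod (w := fun k : ℕ => k + 1) Finset.univ
        (fun i => hInP (r i + (w i : ℕ)).toNat) (fun i => (r i + (w i : ℕ)).toNat)
        fun i _ => isWeightedHomogeneous_hInP _
      simp only [hP, if_pos (h _)]
      convert this
      zify
      rw [← hM, Finset.sum_add_distrib, ← Equiv.sum_comp w fun i => ((i : ℕ) : ℤ),
        ← Finset.sum_add_distrib]
      exact Finset.sum_congr rfl fun i _ => (Int.toNat_of_nonneg (h i)).symm
    · push Not at h
      obtain ⟨i, hi⟩ := h
      rw [Finset.prod_eq_zero (Finset.mem_univ i) (hP_of_neg hi)]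
      exact isWeightedHomogeneous_zero _ _ _
  rcases Int.units_eq_one_or (Equiv.Perm.sign w) with h | h <;> rw [h]
  · simpa using key
  · simpa using key.neg

/-- The virtual character attached to a strictly decreasing sequence has norm one. -/
theorem sum_altCoeff_sq_eq {α : Type*} [Fintype α] [DecidableEq α] (hr : StrictAnti r)
    (hr0 : ∀ i, 0 ≤ r i + ((N : ℤ) - 1)) (hM : ∑ i, (r i + (i : ℕ)) = Fintype.card α) :
    ∑ σ : Equiv.Perm α, altCoeff r (fixSum X σ) * altCoeff r (fixSum X σ) =
      (Fintype.card α).factorial := by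
  rw [sum_altCoeff_sq]
  refine (congrArg _ (Eq.trans ?_ (hallP_sch_self r hr hr0))).trans (mul_one _)
  have hs : ∀ d ∈ (sch r).support, zQ d * coeff d (hInP (Fintype.card α)) = 1 := fun d hd =>
    zQ_mul_coeff_hInP d _ (isWeightedHomogeneous_sch r _ hM (mem_support_iff.mp hd))
  have h2 : hallP (sch r) (sch r) =
      ∑ d ∈ (sch r).support, zQ d * coeff d (sch r) * coeff d (sch r) := by
    conv_lhs => rw [← LinearMap.flip_apply, (sch r).as_sum, map_sum]
    simp only [← (sch r).as_sum, LinearMap.flip_apply, hallP_monomial]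
  rw [h2]
  refine (Finset.sum_subset (fun d hd => ?_) fun d _ hd => ?_).symm.trans
    (Finset.sum_congr rfl fun d hd => ?_)
  · rw [mem_support_iff]
    intro h0
    simpa [h0] using hs d hd
  · rw [hallP_monomial, notMem_support_iff.mp hd]; simp
  · rw [hallP_monomial]
    linear_combination zQ d * coeff d (sch r) ^ 2 * hs d hd

end Character

section Colourings

variable {α : Type} [Fintype α] {N : ℕ} (r : Fin N → ℤ)

/-- Signed colourings whose colour multiplicities are the exponents of a Jacobi-Trudi term. -/
abbrev Colouring (α : Type) [Fintype α] (r : Fin N → ℤ) (ε : ℤˣ) : Type :=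
  {p : Equiv.Perm (Fin N) × (α → Fin N) //
    Equiv.Perm.sign p.1 = ε ∧ ∀ i, r i + (p.1 i : ℕ) = fibre p.2 i}

theorem fibre_comp {Y : Type*} [DecidableEq Y] (f : α → Y) (σ : Equiv.Perm α) :
    fibre (f ∘ σ) = fibre f :=
  funext fun _ => Fintype.card_congr
    (σ.subtypeEquiv fun _ => Iff.rfl)

variable [DecidableEq α]

/-- The action of permutations on signed colourings. -/
@[reducible] def colouringAction (ε : ℤˣ) : MulAction (Equiv.Perm α) (Colouring α r ε) where
  smul σ p := ⟨(p.1.1, p.1.2 ∘ ⇑σ⁻¹), p.2.1, fun i => by rw [fibre_comp]; exact p.2.2 i⟩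
  one_smul p := rfl
  mul_smul σ τ p := by
    refine Subtype.ext (Prod.ext rfl ?_)
    change p.1.2 ∘ ⇑(σ * τ)⁻¹ = (p.1.2 ∘ ⇑τ⁻¹) ∘ ⇑σ⁻¹
    rw [mul_inv_rev, Equiv.Perm.coe_mul, Function.comp_assoc]

/-- The permutation representation on signed colourings. -/
def colouringPerm (ε : ℤˣ) : Equiv.Perm α →* Equiv.Perm (Colouring α r ε) :=
  letI := colouringAction (α := α) r ε
  MulAction.toPermHom _ _

theorem card_fixed_colouring (ε : ℤˣ) (σ : Equiv.Perm α) :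
    (Fintype.card {x // colouringPerm r ε σ x = x} : ℚ) =
      ∑ w : Equiv.Perm (Fin N), ∑ f : α → Fin N with f ∘ σ = f,
        if Equiv.Perm.sign w = ε ∧ ∀ i, r i + (w i : ℕ) = fibre f i then 1 else 0 := by
  simp only [Finset.sum_filter]
  rw [← Fintype.sum_prod_type', Finset.sum_congr rfl fun p _ => by rw [← ite_and],
    Finset.sum_boole, Nat.cast_inj, ← Fintype.card_subtype]
  have hfix : ∀ x : Colouring α r ε, colouringPerm r ε σ x = x ↔ x.1.2 ∘ σ = x.1.2 := fun x => by
    have h : colouringPerm r ε σ x = x ↔ x.1.2 ∘ ⇑σ⁻¹ = x.1.2 :=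
      Subtype.ext_iff.trans (Prod.ext_iff.trans (and_iff_right rfl))
    rw [h]
    constructor <;> intro h <;> funext a
    · simpa using (congrFun h (σ a)).symm
    · simpa using (congrFun h (σ⁻¹ a)).symm
  exact Fintype.card_congr
    { toFun := fun x => ⟨x.1.1, (hfix x.1).mp x.2, x.1.2⟩
      invFun := fun x => ⟨⟨x.1, x.2.2⟩, (hfix _).mpr x.2.1⟩
      left_inv := fun _ => rfl
      right_inv := fun _ => rfl }

theorem altCoeff_fixSum (σ : Equiv.Perm α) :
    altCoeff r (fixSum X σ) = (Fintype.card {x // colouringPerm r 1 σ x = x} : ℚ) -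
      Fintype.card {x // colouringPerm r (-1) σ x = x} := by
  rw [card_fixed_colouring, card_fixed_colouring, ← Finset.sum_sub_distrib, altCoeff,
    LinearMap.sum_apply]
  refine Finset.sum_congr rfl fun w _ => ?_
  rw [← Finset.sum_sub_distrib, LinearMap.smul_apply, fixSum, map_sum, Finset.smul_sum]
  refine Finset.sum_congr rfl fun f _ => ?_
  have h : (∏ a, X (f a) : MvPolynomial (Fin N) ℚ) =
      monomial (Finsupp.equivFunOnFinite.symm (fibre f)) 1 := by
    rw [prod_comp_eq, monomial_eq]; simp [Finsupp.prod_fintype]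
  rw [h, cz_monomial]
  rcases Int.units_eq_one_or (Equiv.Perm.sign w) with h | h <;>
    split_ifs <;> simp_all

end Colourings

section Positivity

variable {N : ℕ} (r : Fin N → ℤ)

theorem sch_eq_zero_of_eq {i j : Fin N} (hij : i ≠ j) (h : r i = r j) : sch r = 0 :=
  Matrix.det_zero_of_row_eq hij (funext fun k => by simp [h])

theorem sch_eq_zero_of_neg {i : Fin N} (h : r i + ((N : ℤ) - 1) < 0) : sch r = 0 :=
  Matrix.det_eq_zero_of_row_eq_zero i fun j => hP_of_neg (by omega)

theorem add_le_of_strictAnti {r : Fin N → ℤ} (hr : StrictAnti r) {i j : Fin N} (hij : i ≤ j) :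
    r j + (j : ℕ) ≤ r i + (i : ℕ) := by
  have key : ∀ (d : ℕ) (i j : Fin N), (j : ℕ) = i + d → r j + (j : ℕ) ≤ r i + (i : ℕ) := by
    intro d
    induction d with
    | zero => intro i j h; obtain rfl : j = i := Fin.ext (by simpa using h); rfl
    | succ d ih =>
      intro i j h
      have h1 := ih i ⟨i + d, by omega⟩ rfl
      have h2 := hr (show (⟨i + d, by omega⟩ : Fin N) < j from Fin.lt_def.mpr (by simp; omega))
      dsimp only at h1
      omega
  exact key (j - i) i j (by have := Fin.le_def.mp hij; omega)

theorem add_nonneg_of_strictAnti {r : Fin N → ℤ} (hr : StrictAnti r)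
    (hr0 : ∀ i, 0 ≤ r i + ((N : ℤ) - 1)) (i : Fin N) : 0 ≤ r i + (i : ℕ) := by
  have hi := i.isLt
  have h := add_le_of_strictAnti hr (show i ≤ ⟨N - 1, by omega⟩ from Fin.le_def.mpr (by
    dsimp only; omega))
  have := hr0 ⟨N - 1, by omega⟩
  dsimp only at h
  omega

theorem strictAnti_update {r : Fin N → ℤ} (hr : StrictAnti r) (i : Fin N)
    (h : ∀ j, j ≠ i → r i - 1 ≠ r j) : StrictAnti (Function.update r i (r i - 1)) := by
  intro a b hab
  by_cases ha : a = i
  · subst ha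
    have := h b hab.ne'
    have := hr hab
    simp [hab.ne']; omega
  · by_cases hb : b = i
    · subst hb
      have := hr hab
      simp [ha]; omega
    · simpa [ha, hb] using hr hab

theorem hallP_X_pow_sch_pos (M : ℕ) (hr : StrictAnti r) (hr0 : ∀ i, 0 ≤ r i + ((N : ℤ) - 1))
    (hM : ∑ i, (r i + (i : ℕ)) = M) : 0 < hallP (X 0 ^ M) (sch r) := by
  induction M generalizing r with
  | zero =>
    have h0 : r = fun i : Fin N => -((i : ℕ) : ℤ) := funext fun i => by
      have := (Finset.sum_eq_zero_iff_of_nonneg fun i _ =>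
        add_nonneg_of_strictAnti hr hr0 i).mp (by simpa using hM) i (Finset.mem_univ i)
      omega
    rw [h0, sch_neg_eq_one, pow_zero, ← C_1, C_apply, hallP_monomial]
    simp [zQ]
  | succ M ih =>
    rw [pow_succ', hallP_X_mul, dP_sch, map_sum]
    simp only [Nat.cast_zero, zero_add]
    have hsum : ∀ i, ∑ j, (Function.update r i (r i - 1) j + (j : ℕ)) = M := fun i => by
      have : ∀ j, Function.update r i (r i - 1) j + (j : ℕ) =
          r j + (j : ℕ) - if j = i then 1 else 0 := fun j => by
        by_cases h : j = i
        · subst h; simp; ring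
        · simp [h]
      rw [Finset.sum_congr rfl fun j _ => this j, Finset.sum_sub_distrib, hM]
      simp
    have hlow : ∀ i, 0 ≤ r i - 1 + ((N : ℤ) - 1) → ∀ j,
        0 ≤ Function.update r i (r i - 1) j + ((N : ℤ) - 1) := fun i hi j => by
      by_cases h : j = i
      · subst h; simpa using hi
      · simpa [h] using hr0 j
    refine Finset.sum_pos' (fun i _ => ?_) ?_
    · by_cases h1 : ∃ j, j ≠ i ∧ r i - 1 = r j
      · obtain ⟨j, hj, h1⟩ := h1
        rw [sch_eq_zero_of_eq _ hj.symm (by simp [hj, h1]), map_zero]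
      · push Not at h1
        by_cases h2 : 0 ≤ r i - 1 + ((N : ℤ) - 1)
        · exact (ih _ (strictAnti_update hr i h1) (hlow i h2) (hsum i)).le
        · rw [sch_eq_zero_of_neg (i := i) _ (by simpa using h2), map_zero]
    · obtain ⟨i, hi, hmax⟩ : ∃ i, 0 < r i + (i : ℕ) ∧ ∀ j, i < j → r j + (j : ℕ) ≤ 0 := by
        have hne : (Finset.univ.filter fun i => 0 < r i + (i : ℕ)).Nonempty := by
          by_contra h
          rw [Finset.not_nonempty_iff_eq_empty, Finset.filter_eq_empty_iff] at h
          have := Finset.sum_nonpos fun i (hi : i ∈ Finset.univ) => not_lt.mp (h hi)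
          omega
        refine ⟨Finset.max' _ hne, (Finset.mem_filter.mp (Finset.max'_mem _ hne)).2,
          fun j hj => ?_⟩
        by_contra h
        exact absurd (Finset.le_max' _ j (by simpa using h)) (not_le.mpr hj)
      refine ⟨i, Finset.mem_univ i, ih _ (strictAnti_update hr i fun j hj => ?_)
        (hlow i (by omega)) (hsum i)⟩
      rcases lt_or_gt_of_ne hj with h | h
      · have := hr h; omega
      · have := hmax j h
        have := Fin.lt_def.mp h
        omega

theorem hallP_foulkesP_nonneg (n : ℕ) (hr : StrictAnti r) (hr0 : ∀ i, 0 ≤ r i + ((N : ℤ) - 1))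
    (hM : ∑ i, (r i + (i : ℕ)) = (2 * n : ℕ)) : 0 ≤ hallP (foulkesP n) (sch r) := by
  have hcard : Fintype.card (Fin n ⊕ Fin n) = 2 * n := by simp; ring
  have key := sum_card_fixed_sub_nonneg
    ((Equiv.Perm.sumCongrHom (Fin n) (Fin n)).comp
      ((MonoidHom.id (Equiv.Perm (Fin n))).prod (MonoidHom.id _)))
    (colouringPerm (α := Fin n ⊕ Fin n) r 1) (colouringPerm r (-1))
    (fun σ => altCoeff r (fixSum X σ)) (fun σ => altCoeff_fixSum r σ)
    (by
      rw [sum_altCoeff_sq_eq r hr hr0 (by rw [hcard]; exact hM), Nat.card_eq_fintype_card,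
        Fintype.card_perm])
    (by
      rw [fixSum_one, hcard]
      have := hallP_X_pow_sch_pos r (2 * n) hr hr0 hM
      rw [hallP_sch, map_pow, pw_X] at this
      simpa using this)
  have h2 := sum_altCoeff_sumCongr r n
  have h3 : 0 ≤ (n.factorial : ℚ) * hallP (foulkesP n) (sch r) := by
    rw [← h2]; exact key
  exact nonneg_of_mul_nonneg_right h3 (by positivity)

end Positivity

/-- Plethysm by the power sum `p_{k+1}` in power sum coordinates. -/
noncomputable def frob (k : ℕ) : MvPolynomial ℕ ℚ →ₐ[ℚ] MvPolynomial ℕ ℚ :=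
  aeval fun i => X ((i + 1) * (k + 1) - 1)

theorem toP_psub (k : ℕ) (g : SymF) : toP (psub (k + 1) g) = frob k (toP g) := by
  have h : toP.comp (aeval fun i => pSym ((i + 1) * (k + 1))) = frob k := by
    ext i : 1
    have hi : (i + 1) * (k + 1) = ((i + 1) * (k + 1) - 1) + 1 :=
      (Nat.succ_pred_eq_of_pos (by positivity)).symm
    rw [AlgHom.comp_apply, aeval_X, frob, aeval_X, hi, toP_pSym, Nat.add_sub_cancel]
  exact DFunLike.congr_fun h _

theorem toP_pleth (f g : SymF) :
    toP (pleth f g) = aeval (fun i => frob i (toP g)) (toP f) := by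
  have h : toP.comp (aeval fun i => psub (i + 1) g) = aeval fun i => frob i (toP g) := by
    ext i : 1
    rw [AlgHom.comp_apply, aeval_X, aeval_X, toP_psub]
  exact DFunLike.congr_fun h _

theorem frob_X_zero (k : ℕ) : frob k (X 0) = X k := by simp [frob]

theorem frob_zero (f : MvPolynomial ℕ ℚ) : frob 0 f = f := by
  simp [frob]

theorem hInP_two : hInP 2 = (2 : ℚ)⁻¹ • (X 0 * X 0 + X 1) := by
  have := hInP_succ 1
  norm_num [Finset.sum_range_succ, hInP_one, hInP_zero] at this
  rw [← this, smul_smul]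
  norm_num

theorem toP_pleth_hh_sq (n : ℕ) : toP (pleth (hh n) (hh 1 * hh 1)) = foulkesP n := by
  rw [toP_pleth, map_mul, toP_hh, toP_hh, hInP_one, foulkesP]
  simp only [map_mul, frob_X_zero, sq]

theorem toP_pleth_two (m : ℕ) : toP (pleth (hh 2) (hh 1 * hh m)) =
    (2 : ℚ)⁻¹ • (X 0 * (X 0 * (hInP m * hInP m)) + X 1 * frob 1 (hInP m)) := by
  rw [toP_pleth, map_mul, toP_hh, toP_hh, toP_hh, hInP_one, hInP_two, map_smul, map_add, map_mul,
    aeval_X, aeval_X, frob_zero, map_mul, frob_X_zero]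
  congr 2
  ring

theorem dP_C (k : ℕ) (c : ℚ) : dP k (C c) = 0 :=
  Derivation.map_algebraMap (dP k) c

theorem dP_foulkesP (k n : ℕ) : dP k (foulkesP n) =
    if k < n then 2 * X k * foulkesP (n - (k + 1)) else 0 := by
  have key : ∀ g : MvPolynomial ℕ ℚ, dP k (aeval (fun i => (X i : MvPolynomial ℕ ℚ) ^ 2) g) =
      2 * X k * aeval (fun i => (X i : MvPolynomial ℕ ℚ) ^ 2) (dP k g) := fun g => by
    have hX : ∀ i : ℕ, aeval (fun i => (X i : MvPolynomial ℕ ℚ) ^ 2) (X i : MvPolynomial ℕ ℚ) =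
        X i * X i := by simp [sq]
    have hC : ∀ c : ℚ, aeval (fun i => (X i : MvPolynomial ℕ ℚ) ^ 2) (C c : MvPolynomial ℕ ℚ) =
        C c := by simp
    generalize (aeval fun i => (X i : MvPolynomial ℕ ℚ) ^ 2 :
      MvPolynomial ℕ ℚ →ₐ[ℚ] MvPolynomial ℕ ℚ) = Φ at hX hC ⊢
    induction g using MvPolynomial.induction_on with
    | C a => rw [hC, dP_C]; simp
    | add p q hp hq => simp only [map_add, hp, hq, mul_add]
    | mul_X p i hp =>
      simp only [map_mul, Derivation.leibniz, hp, hX, smul_eq_mul, map_add, dP_X]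
      split_ifs with h
      · subst h; simp only [map_add, hC]; ring
      · simp only [mul_zero, map_zero]; ring
  rw [foulkesP, key, dP_hInP]
  split_ifs
  · rfl
  · simp

theorem hallP_comm (f g : MvPolynomial ℕ ℚ) : hallP f g = hallP g f := by
  induction f using MvPolynomial.induction_on' with
  | add p q hp hq => simp [hp, hq]
  | monomial d a =>
    induction g using MvPolynomial.induction_on' with
    | add p q hp hq => rw [map_add, map_add, hp, hq]; rfl
    | monomial e b =>
      simp only [hallP_monomial, coeff_monomial]
      by_cases h : d = e
      · subst h; simp; ring
      · simp [h, Ne.symm h]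

theorem hallP_mul_X (k : ℕ) (f g : MvPolynomial ℕ ℚ) :
    hallP f (X k * g) = hallP (dP k f) g := by
  rw [hallP_comm, hallP_X_mul, hallP_comm]

/-- Products of fewer than `N` complete homogeneous functions are orthogonal to Schur functions
of length `N`. -/
theorem hallP_prod_sch_eq_zero {k N : ℕ} (μ : Fin k → ℤ) (hk : k < N) (r : Fin N → ℤ)
    (hr : ∀ i, 1 ≤ r i + ((N : ℤ) - 1)) : hallP (∏ i, hP (μ i)) (sch r) = 0 := by
  rw [hallP_comm, hallP_prod_hP, pw_sch_eq_zero _ (by simpa using hk) r hr, map_zero]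

theorem eq_of_dP_eq {f g : MvPolynomial ℕ ℚ} (h0 : constantCoeff f = constantCoeff g)
    (h : ∀ k, dP k f = dP k g) : f = g := by
  ext d
  by_cases hd : d = 0
  · subst hd; exact h0
  · obtain ⟨k, hk⟩ := Finsupp.ne_iff.mp hd
    rw [Finsupp.zero_apply] at hk
    have hd' : d - Finsupp.single k 1 + Finsupp.single k 1 = d :=
      tsub_add_cancel_of_le (Finsupp.single_le_iff.mpr (Nat.one_le_iff_ne_zero.mpr hk))
    have hk' := congrArg (coeff (d - Finsupp.single k 1)) (h k)
    simp only [dP, Derivation.smul_apply, coeff_smul, coeff_pderiv, hd', smul_eq_mul] at hk'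
    exact mul_right_cancel₀ (by positivity) (mul_left_cancel₀ (by positivity) hk')

theorem dP_frob_one (k : ℕ) (f : MvPolynomial ℕ ℚ) : dP k (frob 1 f) =
    if k % 2 = 1 then 2 * frob 1 (dP (k / 2) f) else 0 := by
  have hX : ∀ i, frob 1 (X i) = X (2 * i + 1) := fun i => by simp [frob]; omega
  have hC : ∀ c : ℚ, frob 1 (C c) = C c := fun c => by simp [frob]
  induction f using MvPolynomial.induction_on with
  | C a => rw [hC, dP_C, dP_C]; simp
  | add p q hp hq => simp only [map_add, hp, hq]; split_ifs <;> ring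
  | mul_X p i hp =>
    simp only [map_mul, Derivation.leibniz, hp, hX, smul_eq_mul, map_add, dP_X]
    by_cases hk : k % 2 = 1
    · by_cases h : i = k / 2
      · subst h
        have hk2 : 2 * (k / 2) + 1 = k := by omega
        have hk3 : (C (k : ℚ) : MvPolynomial ℕ ℚ) = 2 * C ((k / 2 : ℕ) : ℚ) + 1 := by
          have : ((k : ℕ) : ℚ) = 2 * (k / 2 : ℕ) + 1 := by exact_mod_cast hk2.symm
          rw [this, C_add, C_mul, C_1, map_ofNat]
        simp only [hk2, hk, if_true, map_add, hC, hk3, map_one]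
        ring
      · rw [if_neg (by omega), if_pos hk, if_pos hk, if_neg h]
        simp only [mul_zero, map_zero]
        ring
    · rw [if_neg (by omega), if_neg hk, if_neg hk]
      simp

/-- The alternating sums of products of two complete homogeneous functions. -/
noncomputable def altSq (M : ℕ) : MvPolynomial ℕ ℚ :=
  ∑ p ∈ Finset.HasAntidiagonal.antidiagonal M, (-1) ^ p.1 * (hInP p.1 * hInP p.2)

theorem sum_antidiagonal_ite {A : Type*} [AddCommMonoid A] (g : ℕ → ℕ → A) (K M : ℕ) :
    ∑ p ∈ Finset.HasAntidiagonal.antidiagonal M, (if K ≤ p.1 then g (p.1 - K) p.2 else 0) =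
      if K ≤ M then ∑ p ∈ Finset.HasAntidiagonal.antidiagonal (M - K), g p.1 p.2 else 0 := by
  induction K generalizing M with
  | zero => simp
  | succ K ih =>
    cases M with
    | zero => simp
    | succ M =>
      rw [Finset.Nat.sum_antidiagonal_succ]
      simpa using ih M

theorem dP_altSq (k M : ℕ) : dP k (altSq M) =
    if k < M then (1 + (-1) ^ (k + 1)) * altSq (M - (k + 1)) else 0 := by
  have h1 := sum_antidiagonal_ite
    (fun a b => (-1) ^ (k + 1) * ((-1) ^ a * (hInP a * hInP b))) (k + 1) M
  have h2 := sum_antidiagonal_ite (fun a b => (-1) ^ b * (hInP b * hInP a)) (k + 1) M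
  rw [← Finset.Nat.sum_antidiagonal_swap,
      ← Finset.Nat.sum_antidiagonal_swap (n := M - (k + 1))] at h2
  have h3 := congrArg₂ (· + ·) h1 h2
  simp only [← Finset.sum_add_distrib, ← Finset.mul_sum, Prod.fst_swap, Prod.snd_swap,
    Nat.add_one_le_iff] at h3
  refine Eq.trans ?_ (h3.trans ?_)
  · rw [altSq, map_sum]
    refine Finset.sum_congr rfl fun p _ => ?_
    have hs : dP k ((-1) ^ p.1 * (hInP p.1 * hInP p.2)) =
        (-1) ^ p.1 * dP k (hInP p.1 * hInP p.2) := by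
      rcases neg_one_pow_eq_or (MvPolynomial ℕ ℚ) p.1 with h | h <;> simp [h]
    rw [hs, Derivation.leibniz, dP_hInP, dP_hInP, smul_eq_mul, smul_eq_mul]
    have hp : k < p.1 → (-1 : MvPolynomial ℕ ℚ) ^ (k + 1) * (-1) ^ (p.1 - (k + 1)) =
        (-1) ^ p.1 := fun h => by rw [← pow_add]; congr 1; omega
    split_ifs with h1 h2 h2
    · linear_combination -hInP (p.1 - (k + 1)) * hInP p.2 * hp h2
    · ring
    · linear_combination -hInP (p.1 - (k + 1)) * hInP p.2 * hp h2
    · ring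
  · simp only [altSq]
    split_ifs <;> ring

theorem constantCoeff_hInP (n : ℕ) : constantCoeff (hInP n) = if n = 0 then 1 else 0 := by
  rw [← hP_natCast, constantCoeff_hP]
  simp

theorem constantCoeff_frob_one (f : MvPolynomial ℕ ℚ) :
    constantCoeff (frob 1 f) = constantCoeff f := by
  have : (constantCoeff (R := ℚ) (σ := ℕ)).comp (frob 1).toRingHom = constantCoeff := by
    ext i <;> simp [frob]
  exact DFunLike.congr_fun this f

theorem altSq_eq (M : ℕ) : altSq M = if M % 2 = 0 then frob 1 (hInP (M / 2)) else 0 := by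
  induction M using Nat.strong_induction_on with
  | _ M ih =>
    refine eq_of_dP_eq ?_ fun k => ?_
    · rcases Nat.eq_zero_or_pos M with rfl | hM
      · simp [altSq, hInP_zero]
      · rw [altSq, map_sum, Finset.sum_eq_zero fun p hp => ?_]
        · split_ifs with h
          · rw [constantCoeff_frob_one, constantCoeff_hInP, if_neg (by omega)]
          · simp
        · rw [Finset.HasAntidiagonal.mem_antidiagonal] at hp
          rw [map_mul, map_mul, constantCoeff_hInP, constantCoeff_hInP]
          by_cases h : p.1 = 0
          · rw [if_neg (show p.2 ≠ 0 by omega)]; simp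
          · simp [h]
    · rw [dP_altSq]
      have hM : dP k (if M % 2 = 0 then frob 1 (hInP (M / 2)) else 0) =
          if M % 2 = 0 then dP k (frob 1 (hInP (M / 2))) else 0 := by
        split_ifs <;> simp
      rw [hM, dP_frob_one, dP_hInP]
      by_cases hk : k % 2 = 1
      · have : Even (k + 1) := Nat.even_iff.mpr (by omega)
        rw [this.neg_one_pow, if_pos hk]
        by_cases hkM : k < M
        · rw [if_pos hkM, ih _ (by omega), show (M - (k + 1)) % 2 = M % 2 by omega,
            show (M - (k + 1)) / 2 = M / 2 - (k / 2 + 1) by omega]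
          split_ifs <;> first | omega | ring
        · rw [if_neg hkM]
          split_ifs <;> first | omega | simp
      · have : Odd (k + 1) := Nat.odd_iff.mpr (by omega)
        rw [this.neg_one_pow, if_neg hk]
        simp

/-- The Jacobi-Trudi determinant with two rows. -/
noncomputable def twoRow (p q : ℤ) : MvPolynomial ℕ ℚ := hP p * hP q - hP (p + 1) * hP (q - 1)

theorem twoRow_of_neg {p q : ℤ} (hq : q < 0) : twoRow p q = 0 := by
  rw [twoRow, hP_of_neg hq, hP_of_neg (z := q - 1) (by omega)]
  ring

theorem twoRow_swap (p q : ℤ) : twoRow p q = -twoRow (q - 1) (p + 1) := by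
  rw [twoRow, twoRow, sub_add_cancel, add_sub_cancel_right]
  ring

theorem dP_twoRow (k : ℕ) (p q : ℤ) :
    dP k (twoRow p q) = twoRow (p - (k + 1)) q + twoRow p (q - (k + 1)) := by
  simp only [twoRow, map_sub, Derivation.leibniz, dP_hP, smul_eq_mul]
  rw [show p + 1 - (k + 1 : ℤ) = p - (k + 1) + 1 by ring,
    show q - 1 - (k + 1 : ℤ) = q - (k + 1) - 1 by ring]
  ring

theorem sch_two (r : Fin 2 → ℤ) : sch r = twoRow (r 0) (r 1 + 1) := by
  simp [sch, Matrix.det_fin_two, twoRow]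

theorem hallP_hP_mul_hP {ι : Type*} (s : Finset ι) (e : ι → Fin 2 → ℕ) (f : MvPolynomial ℕ ℚ)
    (hf : pw X f = ∑ c ∈ s, ∏ i, (X i : MvPolynomial (Fin 2) ℚ) ^ e c i) (p q : ℤ) :
    hallP f (hP p * hP q) = ((s.filter fun c => p = e c 0 ∧ q = e c 1).card : ℚ) := by
  have h := hallP_prod_hP f ![p, q]
  rw [Fin.prod_univ_two] at h
  change hallP f (hP p * hP q) = _ at h
  rw [h, hf, map_sum, ← Finset.sum_boole]
  refine Finset.sum_congr rfl fun c _ => ?_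
  have hX : (∏ i, X i ^ e c i : MvPolynomial (Fin 2) ℚ) =
      monomial (Finsupp.equivFunOnFinite.symm (e c)) 1 := by
    rw [monomial_eq]; simp [Finsupp.prod_fintype]
  rw [hX, cz_monomial]
  simp [Fin.forall_fin_two]

theorem hallP_sq_hP_mul_hP (m : ℕ) {p q : ℤ} (hpq : p + q = 2 * m) (hq : -1 ≤ q) (hqp : q ≤ p) :
    hallP (hInP m * hInP m) (hP p * hP q) = q + 1 := by
  rw [hallP_hP_mul_hP ((Finset.univ.piAntidiag m) ×ˢ (Finset.univ.piAntidiag m))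
    (fun c i => c.1 i + c.2 i) _ (by
      rw [map_mul, pw_hInP, Finset.sum_mul_sum, ← Finset.sum_product']
      simp only [pow_add, Finset.prod_mul_distrib])]
  rw [Finset.card_nbij' (t := Finset.range (q + 1).toNat) (fun c => c.1 1)
    (fun k => (![m - k, k], ![m - q.toNat + k, q.toNat - k]))]
  · rw [Finset.card_range]
    have : ((q + 1).toNat : ℤ) = q + 1 := Int.toNat_of_nonneg (by omega)
    exact_mod_cast congrArg (Int.cast : ℤ → ℚ) this
  · rintro ⟨c, d⟩ h
    simp [Fin.sum_univ_two] at h ⊢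
    omega
  · intro k h
    simp [Fin.sum_univ_two] at h ⊢
    omega
  · rintro ⟨c, d⟩ h
    simp [Fin.sum_univ_two] at h ⊢
    constructor <;> funext i <;> fin_cases i <;> simp <;> omega
  · intro k h
    simp

theorem pw_frob_one {N : ℕ} (f : MvPolynomial ℕ ℚ) :
    pw (X : Fin N → MvPolynomial (Fin N) ℚ) (frob 1 f) =
      pw (fun i : Fin N => (X i : MvPolynomial (Fin N) ℚ) ^ 2) f := by
  have h : (pw (X : Fin N → MvPolynomial (Fin N) ℚ)).comp (frob 1) =
      pw fun i : Fin N => (X i : MvPolynomial (Fin N) ℚ) ^ 2 := by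
    ext k : 1
    rw [AlgHom.comp_apply, frob, aeval_X, pw_X, pw_X]
    refine Finset.sum_congr rfl fun i _ => ?_
    rw [← pow_mul]
    congr 1
    omega
  exact DFunLike.congr_fun h f

theorem hallP_frob_hP_mul_hP (m : ℕ) {p q : ℤ} (hpq : p + q = 2 * m) (hp : 0 ≤ p) :
    hallP (frob 1 (hInP m)) (hP p * hP q) = if 0 ≤ q ∧ q % 2 = 0 then 1 else 0 := by
  rw [hallP_hP_mul_hP (Finset.univ.piAntidiag m) (fun c i => 2 * c i) _ (by
      rw [pw_frob_one, pw_hInP]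
      simp only [pow_mul])]
  split_ifs with h
  · rw [Nat.cast_eq_one, Finset.card_eq_one]
    refine ⟨![(p / 2).toNat, (q / 2).toNat], ?_⟩
    ext c
    simp [Fin.sum_univ_two, funext_iff, Fin.forall_fin_two]
    omega
  · rw [Nat.cast_eq_zero, Finset.card_eq_zero, Finset.filter_eq_empty_iff]
    intro c _
    omega

theorem hallP_foulkesP_hP_mul_hP (n : ℕ) {p q : ℕ} (hpq : p + q = 2 * n) (hqp : q ≤ p) :
    hallP (foulkesP n) (hP p * hP q) =
      ∑ b ∈ Finset.range (q / 2 + 1), ((q - 2 * b : ℕ) + 1 : ℚ) := by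
  rw [hallP_hP_mul_hP (Finset.univ.piAntidiag n) (fun c : Fin 2 × Fin 2 → ℕ =>
    ![2 * c (0, 0) + c (0, 1) + c (1, 0), 2 * c (1, 1) + c (0, 1) + c (1, 0)]) _ (by
      rw [pw_foulkesP, pw_hInP]
      refine Finset.sum_congr rfl fun c _ => ?_
      simp [Fintype.prod_prod_type, Fin.prod_univ_two]
      ring)]
  rw [Finset.card_nbij' (t := (Finset.range (q / 2 + 1)).sigma
      fun b => Finset.range (q - 2 * b + 1))
    (fun c => ⟨c (1, 1), c (0, 1)⟩)
    (fun x => fun y => ![![n - q + x.1, x.2], ![q - 2 * x.1 - x.2, x.1]] y.1 y.2)]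
  · rw [Finset.card_sigma]
    simp
  · intro c h
    simp [Fintype.sum_prod_type, Fin.sum_univ_two] at h ⊢
    omega
  · rintro ⟨b, e⟩ h
    simp [Fintype.sum_prod_type, Fin.sum_univ_two] at h ⊢
    omega
  · intro c h
    simp [Fintype.sum_prod_type, Fin.sum_univ_two] at h
    funext ⟨i, j⟩
    fin_cases i <;> fin_cases j <;> simp <;> omega
  · rintro ⟨b, e⟩ h
    simp

theorem hallP_sq_twoRow (m : ℕ) {p q : ℤ} (hpq : p + q = 2 * m) (hq : 0 ≤ q) (hqp : q ≤ p) :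
    hallP (hInP m * hInP m) (twoRow p q) = 1 := by
  rw [twoRow, map_sub, hallP_sq_hP_mul_hP m hpq (by omega) hqp,
    hallP_sq_hP_mul_hP m (by omega) (by omega) (by omega)]
  push_cast
  ring

theorem hallP_frob_twoRow (m : ℕ) {p q : ℤ} (hpq : p + q = 2 * m) (hq : 0 ≤ q) (hqp : q ≤ p) :
    hallP (frob 1 (hInP m)) (twoRow p q) = if q % 2 = 0 then 1 else -1 := by
  rw [twoRow, map_sub, hallP_frob_hP_mul_hP m hpq (by omega),
    hallP_frob_hP_mul_hP m (by omega) (by omega)]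
  split_ifs <;> first | omega | norm_num

theorem hallP_foulkesP_twoRow (n : ℕ) {p q : ℤ} (hpq : p + q = 2 * n) (hq : -2 ≤ q)
    (hqp : q ≤ p) : hallP (foulkesP n) (twoRow p q) = ((q / 2 + 1 : ℤ) : ℚ) := by
  rcases lt_trichotomy q 0 with h | rfl | h
  · rw [twoRow_of_neg h, map_zero, show q / 2 + 1 = 0 by omega, Int.cast_zero]
  · lift p to ℕ using hqp
    have := hallP_foulkesP_hP_mul_hP n (p := p) (q := 0) (by omega) (by omega)
    rw [twoRow, hP_of_neg (z := 0 - 1) (by omega), mul_zero, sub_zero]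
    simpa using this
  · obtain ⟨q, rfl⟩ : ∃ k : ℕ, q = (k + 1 : ℕ) := ⟨(q - 1).toNat, by omega⟩
    lift p to ℕ using by omega
    have h1 := hallP_foulkesP_hP_mul_hP n (p := p) (q := q + 1) (by omega) (by omega)
    have h2 := hallP_foulkesP_hP_mul_hP n (p := p + 1) (q := q) (by omega) (by omega)
    rw [twoRow, map_sub, h1, show ((q + 1 : ℕ) : ℤ) - 1 = q by omega,
      show (p : ℤ) + 1 = (p + 1 : ℕ) by omega, h2]
    have h3 : ∀ k, k ≤ (q + 1) / 2 → ∑ b ∈ Finset.range k, ((q + 1 - 2 * b : ℕ) + 1 : ℚ) =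
        ∑ b ∈ Finset.range k, ((q - 2 * b : ℕ) + 1 : ℚ) + k := fun k hk => by
      have : ∀ b ∈ Finset.range k, ((q + 1 - 2 * b : ℕ) + 1 : ℚ) = ((q - 2 * b : ℕ) + 1 : ℚ) + 1 :=
        fun b hb => by
          rw [show q + 1 - 2 * b = q - 2 * b + 1 by have := Finset.mem_range.mp hb; omega]
          push_cast; ring
      rw [Finset.sum_congr rfl this, Finset.sum_add_distrib]
      simp
    have h4 : (((q + 1 : ℕ) : ℤ) / 2 + 1 : ℤ) = (((q + 1) / 2 + 1 : ℕ) : ℤ) := by omega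
    rw [h4, Int.cast_natCast, Nat.cast_add_one, Finset.sum_range_succ, h3 _ le_rfl]
    rcases Nat.mod_two_eq_zero_or_one q with hq2 | hq2
    · rw [show q / 2 + 1 = (q + 1) / 2 + 1 by omega, Finset.sum_range_succ,
        show q + 1 - 2 * ((q + 1) / 2) = 1 by omega, show q - 2 * ((q + 1) / 2) = 0 by omega]
      simp only [Nat.cast_zero, Nat.cast_one]
      ring
    · rw [show q / 2 + 1 = (q + 1) / 2 by omega,
        show q + 1 - 2 * ((q + 1) / 2) = 0 by omega]
      simp only [Nat.cast_zero]
      ring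

theorem hP_two : hP 2 = (2 : ℚ)⁻¹ • (X 0 * X 0 + X 1) := by
  rw [← hInP_two, ← hP_natCast, Nat.cast_ofNat]

theorem sch_three_one (a b : ℤ) : sch ![a, b - 1, -1] =
    X 0 * twoRow a b - twoRow (a + 1) b - twoRow a (b + 1) := by
  have h1 : hP (-1) = 0 := hP_of_neg (by norm_num)
  simp [sch, Matrix.det_fin_three, twoRow, hP_zero, hP_one, h1,
    show (-1 + 2 : ℤ) = 1 by norm_num, show b - 1 + 2 = b + 1 by ring,
    show a + 1 + 1 = a + 2 by ring]
  ring

theorem sch_three_two (a b : ℤ) : sch ![a, b - 1, 0] =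
    hP 2 * twoRow a b - X 0 * (twoRow (a + 1) b + twoRow a (b + 1)) +
      twoRow (a + 1) (b + 1) := by
  simp [sch, Matrix.det_fin_three, twoRow, hP_zero, hP_one,
    show b - 1 + 2 = b + 1 by ring,
    show a + 1 + 1 = a + 2 by ring]
  ring

theorem sch_four_one_one (a b : ℤ) : sch ![a, b - 1, -1, -2] =
    (X 0 * X 0 - hP 2) * twoRow a b - X 0 * (twoRow (a + 1) b + twoRow a (b + 1)) +
      (twoRow a (b + 2) + twoRow (a + 1) (b + 1) + twoRow (a + 2) b) := by
  have h1 : hP (-1) = 0 := hP_of_neg (by norm_num)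
  have h2 : hP (-2) = 0 := hP_of_neg (by norm_num)
  simp [sch, Matrix.det_succ_row_zero, Fin.sum_univ_succ, twoRow, hP_zero, hP_one, h1, h2,
    Fin.succAbove]
  ring_nf

section Values

variable (n : ℕ) (p q : ℤ)

theorem hallP_foulkesP_X_mul (k : ℕ) (g : MvPolynomial ℕ ℚ) (n : ℕ) :
    hallP (foulkesP (n + (k + 1))) (X k * g) = 2 * hallP (foulkesP n) (dP k g) := by
  rw [hallP_mul_X, dP_foulkesP, if_pos (by omega), Nat.add_sub_cancel, mul_assoc, ← map_ofNat C 2,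
    ← smul_eq_C_mul, map_smul, LinearMap.smul_apply, hallP_X_mul, smul_eq_mul]

theorem hallP_foulkesP_X_mul_twoRow : hallP (foulkesP (n + 1)) (X 0 * twoRow p q) =
    2 * (hallP (foulkesP n) (twoRow (p - 1) q) + hallP (foulkesP n) (twoRow p (q - 1))) := by
  rw [hallP_foulkesP_X_mul 0, dP_twoRow, map_add]
  norm_num

theorem hallP_foulkesP_X_one_mul_twoRow : hallP (foulkesP (n + 2)) (X 1 * twoRow p q) =
    2 * (hallP (foulkesP n) (twoRow (p - 2) q) + hallP (foulkesP n) (twoRow p (q - 2))) := by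
  rw [hallP_foulkesP_X_mul 1, dP_twoRow, map_add]
  norm_num

theorem hallP_foulkesP_X_sq_mul_twoRow : hallP (foulkesP (n + 2)) (X 0 * X 0 * twoRow p q) =
    2 * hallP (foulkesP (n + 1)) (twoRow p q) + 4 * (hallP (foulkesP n) (twoRow (p - 2) q) +
      2 * hallP (foulkesP n) (twoRow (p - 1) (q - 1)) + hallP (foulkesP n) (twoRow p (q - 2))) := by
  rw [mul_assoc, hallP_foulkesP_X_mul 0 _ (n + 1), Derivation.leibniz, dP_twoRow, dP_X, if_pos rfl]
  simp only [Nat.cast_zero, zero_add, C_1, smul_eq_mul, mul_one, mul_add, map_add,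
    hallP_foulkesP_X_mul_twoRow]
  rw [sub_sub, sub_sub]
  norm_num
  ring

theorem hallP_foulkesP_hP_two_mul_twoRow : hallP (foulkesP (n + 2)) (hP 2 * twoRow p q) =
    hallP (foulkesP (n + 1)) (twoRow p q) + 3 * hallP (foulkesP n) (twoRow (p - 2) q) +
      4 * hallP (foulkesP n) (twoRow (p - 1) (q - 1)) +
      3 * hallP (foulkesP n) (twoRow p (q - 2)) := by
  rw [hP_two, smul_mul_assoc, map_smul, add_mul, map_add, hallP_foulkesP_X_sq_mul_twoRow,
    hallP_foulkesP_X_one_mul_twoRow, smul_eq_mul]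
  ring

/-- The multiplicity in `hₙ[h₁²]` of the Schur function with shape `(a, b, 1)`. -/
theorem hallP_foulkesP_sch_three_one {a b : ℤ} (hb : 1 ≤ b) (hab : b ≤ a)
    (hn : a + b + 1 = 2 * n) : hallP (foulkesP n) (sch ![a, b - 1, -1]) =
      ((2 * (b / 2) + b % 2 : ℤ) : ℚ) := by
  obtain ⟨n, rfl⟩ : ∃ k, n = k + 1 := ⟨n - 1, by omega⟩
  rw [sch_three_one, map_sub, map_sub, hallP_foulkesP_X_mul_twoRow,
    hallP_foulkesP_twoRow n (by omega) (by omega) (by omega),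
    hallP_foulkesP_twoRow n (by omega) (by omega) (by omega),
    hallP_foulkesP_twoRow (n + 1) (by omega) (by omega) (by omega),
    hallP_foulkesP_twoRow (n + 1) (by omega) (by omega) (by omega)]
  norm_cast
  omega

theorem hallP_foulkesP_twoRow_add_two {p q : ℤ} (hq : q = p + 2) (hn : p + q = 2 * n) :
    hallP (foulkesP n) (twoRow p q) = -(((p + 1) / 2 + 1 : ℤ) : ℚ) := by
  subst hq
  rw [twoRow_swap, map_neg, show p + 2 - 1 = p + 1 by ring,
    hallP_foulkesP_twoRow n (by omega) (by omega) le_rfl]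

theorem hallP_foulkesP_sch_three_two {a b : ℤ} (hb : 2 ≤ b) (hb2 : b % 2 = 0) (hab : b ≤ a)
    (hn : a + b + 2 = 2 * n) : 1 ≤ hallP (foulkesP n) (sch ![a, b - 1, 0]) := by
  obtain ⟨n, rfl⟩ : ∃ k, n = k + 2 := ⟨n - 2, by omega⟩
  rw [sch_three_two, map_add, map_sub, mul_add, map_add, hallP_foulkesP_hP_two_mul_twoRow,
    hallP_foulkesP_X_mul_twoRow, hallP_foulkesP_X_mul_twoRow, add_sub_cancel_right,
    add_sub_cancel_right,
    hallP_foulkesP_twoRow (n + 1) (p := a) (q := b) (by omega) (by omega) (by omega),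
    hallP_foulkesP_twoRow n (p := a - 1) (q := b - 1) (by omega) (by omega) (by omega),
    hallP_foulkesP_twoRow n (p := a) (q := b - 2) (by omega) (by omega) (by omega),
    hallP_foulkesP_twoRow (n + 1) (p := a + 1) (q := b - 1) (by omega) (by omega) (by omega),
    hallP_foulkesP_twoRow (n + 2) (p := a + 1) (q := b + 1) (by omega) (by omega) (by omega)]
  rcases hab.eq_or_lt with rfl | h
  · rw [hallP_foulkesP_twoRow_add_two n (p := b - 2) (q := b) (by omega) (by omega),
      hallP_foulkesP_twoRow_add_two (n + 1) (p := b - 1) (q := b + 1) (by omega) (by omega)]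
    norm_cast
    omega
  · rw [hallP_foulkesP_twoRow n (by omega) (by omega) (by omega),
      hallP_foulkesP_twoRow (n + 1) (by omega) (by omega) (by omega)]
    norm_cast
    omega

theorem hallP_foulkesP_sch_four_one_one {a b : ℤ} (hb : 1 ≤ b) (hab : b ≤ a)
    (hn : a + b + 2 = 2 * n) : 1 ≤ hallP (foulkesP n) (sch ![a, b - 1, -1, -2]) := by
  obtain ⟨n, rfl⟩ : ∃ k, n = k + 2 := ⟨n - 2, by omega⟩
  rw [sch_four_one_one, map_add, map_add, map_add, map_sub, mul_add, map_add, sub_mul, map_sub,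
    hallP_foulkesP_hP_two_mul_twoRow, hallP_foulkesP_X_sq_mul_twoRow,
    hallP_foulkesP_X_mul_twoRow, hallP_foulkesP_X_mul_twoRow, add_sub_cancel_right,
    add_sub_cancel_right,
    hallP_foulkesP_twoRow (n + 1) (p := a) (q := b) (by omega) (by omega) (by omega),
    hallP_foulkesP_twoRow n (p := a - 1) (q := b - 1) (by omega) (by omega) (by omega),
    hallP_foulkesP_twoRow n (p := a) (q := b - 2) (by omega) (by omega) (by omega),
    hallP_foulkesP_twoRow (n + 1) (p := a + 1) (q := b - 1) (by omega) (by omega) (by omega),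
    hallP_foulkesP_twoRow (n + 2) (p := a + 1) (q := b + 1) (by omega) (by omega) (by omega),
    hallP_foulkesP_twoRow (n + 2) (p := a + 2) (q := b) (by omega) (by omega) (by omega)]
  rcases hab.eq_or_lt with rfl | h
  · rw [hallP_foulkesP_twoRow_add_two n (p := b - 2) (q := b) (by omega) (by omega),
      hallP_foulkesP_twoRow_add_two (n + 1) (p := b - 1) (q := b + 1) (by omega) (by omega),
      hallP_foulkesP_twoRow_add_two (n + 2) (p := b) (q := b + 2) (by omega) (by omega)]
    norm_cast
    omega
  · rw [hallP_foulkesP_twoRow n (by omega) (by omega) (by omega),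
      hallP_foulkesP_twoRow (n + 1) (by omega) (by omega) (by omega),
      hallP_foulkesP_twoRow (n + 2) (by omega) (by omega) (by omega)]
    norm_cast
    omega

end Values

/-- The span of the products of `k` complete homogeneous symmetric functions. -/
noncomputable def rowSpan (k : ℕ) : Submodule ℚ (MvPolynomial ℕ ℚ) :=
  Submodule.span ℚ (Set.range fun μ : Fin k → ℤ => ∏ i, hP (μ i))

theorem hP_mem_rowSpan (z : ℤ) : hP z ∈ rowSpan 1 :=
  Submodule.subset_span ⟨fun _ => z, by simp⟩

theorem mul_mem_rowSpan {k l N : ℕ} (hN : k + l = N) {f g : MvPolynomial ℕ ℚ}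
    (hf : f ∈ rowSpan k) (hg : g ∈ rowSpan l) : f * g ∈ rowSpan N := by
  subst hN
  have h := Submodule.mul_mem_mul hf hg
  rw [rowSpan, rowSpan, Submodule.span_mul_span] at h
  refine Submodule.span_mono ?_ h
  rintro _ ⟨_, ⟨μ, rfl⟩, _, ⟨ν, rfl⟩, rfl⟩
  exact ⟨Fin.append μ ν, by simp [Fin.prod_univ_add]⟩

theorem hInP_mul_self_mem_rowSpan (m : ℕ) : hInP m * hInP m ∈ rowSpan 2 := by
  rw [← hP_natCast]
  exact mul_mem_rowSpan one_add_one_eq_two (hP_mem_rowSpan m) (hP_mem_rowSpan m)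

theorem frob_one_hInP_mem_rowSpan (m : ℕ) : frob 1 (hInP m) ∈ rowSpan 2 := by
  have h := altSq_eq (2 * m)
  rw [if_pos (by omega), Nat.mul_div_cancel_left m two_pos, altSq] at h
  rw [← h]
  refine Submodule.sum_mem _ fun p _ => ?_
  rw [show ((-1) ^ p.1 : MvPolynomial ℕ ℚ) = C ((-1) ^ p.1) by simp, ← smul_eq_C_mul,
    ← hP_natCast, ← hP_natCast]
  exact Submodule.smul_mem _ _
    (mul_mem_rowSpan one_add_one_eq_two (hP_mem_rowSpan _) (hP_mem_rowSpan _))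

theorem X_zero_mul_X_zero_mem_rowSpan : (X 0 * X 0 : MvPolynomial ℕ ℚ) ∈ rowSpan 2 := by
  rw [← hP_one]
  exact mul_mem_rowSpan one_add_one_eq_two (hP_mem_rowSpan 1) (hP_mem_rowSpan 1)

theorem X_one_mem_rowSpan : (X 1 : MvPolynomial ℕ ℚ) ∈ rowSpan 2 := by
  simpa [hInP_one, frob_X_zero] using frob_one_hInP_mem_rowSpan 1

theorem toP_pleth_two_mem_rowSpan (m : ℕ) : toP (pleth (hh 2) (hh 1 * hh m)) ∈ rowSpan 4 := by
  rw [toP_pleth_two, ← mul_assoc]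
  exact Submodule.smul_mem _ _ (Submodule.add_mem _
    (mul_mem_rowSpan (k := 2) (l := 2) rfl X_zero_mul_X_zero_mem_rowSpan
      (hInP_mul_self_mem_rowSpan m))
    (mul_mem_rowSpan (k := 2) (l := 2) rfl X_one_mem_rowSpan (frob_one_hInP_mem_rowSpan m)))

theorem hallP_sch_eq_zero_of_mem_rowSpan {k N : ℕ} {f : MvPolynomial ℕ ℚ} (hf : f ∈ rowSpan k)
    (hk : k < N) (r : Fin N → ℤ) (hr : ∀ i, 1 ≤ r i + ((N : ℤ) - 1)) : hallP f (sch r) = 0 := by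
  induction hf using Submodule.span_induction with
  | mem f hf => obtain ⟨μ, rfl⟩ := hf; exact hallP_prod_sch_eq_zero μ hk r hr
  | zero => simp
  | add f g _ _ hf hg => rw [map_add, LinearMap.add_apply, hf, hg, add_zero]
  | smul c f _ hf => rw [map_smul, LinearMap.smul_apply, hf, smul_zero]

theorem hallP_toP_pleth_two (m : ℕ) (g : MvPolynomial ℕ ℚ) :
    hallP (toP (pleth (hh 2) (hh 1 * hh m))) g =
      (hallP (hInP m * hInP m) (dP 0 (dP 0 g)) + hallP (frob 1 (hInP m)) (dP 1 g)) / 2 := by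
  rw [toP_pleth_two, map_smul, map_add, LinearMap.smul_apply, LinearMap.add_apply, hallP_X_mul,
    hallP_X_mul, hallP_X_mul, smul_eq_mul]
  ring

theorem sch_three_drop (x y : ℤ) : sch ![x, y, -2] = twoRow x (y + 1) := by
  simp [sch, Matrix.det_fin_three, twoRow, hP_zero, hP_of_neg]

theorem sch_three_swap (x y z : ℤ) : sch ![x, y, z] = -sch ![x, z, y] := by
  simp [sch, Matrix.det_fin_three]
  ring

theorem sch_four_drop (x y z : ℤ) : sch ![x, y, z, -3] = sch ![x, y, z] := by
  simp [sch, Matrix.det_succ_row_zero, Fin.sum_univ_succ, Fin.succAbove, hP_zero, hP_of_neg]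

theorem sch_four_swap (x y z w : ℤ) : sch ![x, y, z, w] = -sch ![x, y, w, z] := by
  simp [sch, Matrix.det_succ_row_zero, Fin.sum_univ_succ, Fin.succAbove]
  ring

theorem dP_sch_three (k : ℕ) (x y z : ℤ) : dP k (sch ![x, y, z]) =
    sch ![x - (k + 1), y, z] + sch ![x, y - (k + 1), z] + sch ![x, y, z - (k + 1)] := by
  have h (i : Fin 3) (v : Fin 3 → ℤ) (a : ℤ) : Function.update v i a =
      ![if i = 0 then a else v 0, if i = 1 then a else v 1, if i = 2 then a else v 2] := by
    ext j; fin_cases i <;> fin_cases j <;> rfl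
  rw [dP_sch, Fin.sum_univ_three]
  simp only [h]
  rfl

theorem dP_sch_four (k : ℕ) (x y z w : ℤ) : dP k (sch ![x, y, z, w]) =
    sch ![x - (k + 1), y, z, w] + sch ![x, y - (k + 1), z, w] + sch ![x, y, z - (k + 1), w] +
      sch ![x, y, z, w - (k + 1)] := by
  have h (i : Fin 4) (v : Fin 4 → ℤ) (a : ℤ) : Function.update v i a =
      ![if i = 0 then a else v 0, if i = 1 then a else v 1, if i = 2 then a else v 2,
        if i = 3 then a else v 3] := by
    ext j; fin_cases i <;> fin_cases j <;> rfl
  rw [dP_sch, Fin.sum_univ_four]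
  simp only [h]
  rfl

theorem hallP_sch_three_eq_zero {f : MvPolynomial ℕ ℚ} (hf : f ∈ rowSpan 2) {x y z : ℤ}
    (hx : -1 ≤ x) (hy : -1 ≤ y) (hz : -1 ≤ z) : hallP f (sch ![x, y, z]) = 0 := by
  refine hallP_sch_eq_zero_of_mem_rowSpan hf (by norm_num) _ fun i => ?_
  fin_cases i <;> simp <;> omega

theorem hallP_sch_four_eq_zero {f : MvPolynomial ℕ ℚ} (hf : f ∈ rowSpan 2) {x y z w : ℤ}
    (hx : -2 ≤ x) (hy : -2 ≤ y) (hz : -2 ≤ z) (hw : -2 ≤ w) :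
    hallP f (sch ![x, y, z, w]) = 0 := by
  refine hallP_sch_eq_zero_of_mem_rowSpan hf (by norm_num) _ fun i => ?_
  fin_cases i <;> simp <;> omega

theorem hallP_sch_four_eq_zero_of_le {f : MvPolynomial ℕ ℚ} (hf : f ∈ rowSpan 2) {x y z w : ℤ}
    (hx : -1 ≤ x) (hy : -1 ≤ y) (hz : -1 ≤ z) (hw : -3 ≤ w) :
    hallP f (sch ![x, y, z, w]) = 0 := by
  rcases hw.eq_or_lt with rfl | hw
  · rw [sch_four_drop, hallP_sch_three_eq_zero hf hx hy hz]
  · exact hallP_sch_four_eq_zero hf (by omega) (by omega) (by omega) (by omega)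

section Rows

variable {f : MvPolynomial ℕ ℚ}

theorem hallP_dP_one_sch_three (hf : f ∈ rowSpan 2) {a b c : ℤ} (hc : 1 ≤ c) (hcb : c ≤ b)
    (hba : b ≤ a) : hallP f (dP 1 (sch ![a, b - 1, c - 2])) =
      if c = 2 then hallP f (twoRow a b)
      else if b = 1 then -hallP f (twoRow a 0) else 0 := by
  rw [dP_sch_three, map_add, map_add,
    hallP_sch_three_eq_zero hf (by push_cast; omega) (by omega) (by omega),
    zero_add]
  norm_num
  have h1 : hallP f (sch ![a, b - 1 - 2, c - 2]) = if b = 1 then -hallP f (twoRow a 0) else 0 := by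
    split_ifs with h
    · obtain rfl : c = 1 := by omega
      rw [sch_three_swap, h]
      norm_num
      rw [sch_three_drop]
      norm_num
    · exact hallP_sch_three_eq_zero hf (by omega) (by omega) (by omega)
  have h2 : hallP f (sch ![a, b - 1, c - 2 - 2]) = if c = 2 then hallP f (twoRow a b) else 0 := by
    split_ifs with h
    · subst h
      norm_num
      rw [sch_three_drop, sub_add_cancel]
    · rcases eq_or_ne c 1 with rfl | h'
      · rw [sch_eq_zero_of_neg _ (i := 2) (by simp), map_zero]
      · exact hallP_sch_three_eq_zero hf (by omega) (by omega) (by omega)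
  rw [h1, h2]
  split_ifs <;> first | omega | simp

theorem hallP_dP_zero_dP_zero_sch_three (hf : f ∈ rowSpan 2) {a b c : ℤ} (hc : 1 ≤ c)
    (hcb : c ≤ b) (hba : b ≤ a) : hallP f (dP 0 (dP 0 (sch ![a, b - 1, c - 2]))) =
      hallP f (dP 1 (sch ![a, b - 1, c - 2])) + if c = 1 then
        2 * (hallP f (twoRow (a - 1) b) + hallP f (twoRow a (b - 1))) else 0 := by
  have h1 : hallP f (sch ![a - 1, b - 1, c - 2 - 1]) =
      if c = 1 then hallP f (twoRow (a - 1) b) else 0 := by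
    split_ifs with h
    · subst h
      norm_num
      rw [sch_three_drop, sub_add_cancel]
    · exact hallP_sch_three_eq_zero hf (by omega) (by omega) (by omega)
  have h2 : hallP f (sch ![a, b - 1 - 1, c - 2 - 1]) =
      if c = 1 then hallP f (twoRow a (b - 1)) else 0 := by
    split_ifs with h
    · subst h
      norm_num
      rw [sch_three_drop, sub_add_cancel]
    · exact hallP_sch_three_eq_zero hf (by omega) (by omega) (by omega)
  have h3 : hallP f (sch ![a - 1, b - 1 - 1, c - 2]) = 0 :=
    hallP_sch_three_eq_zero hf (by omega) (by omega) (by omega)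
  simp only [dP_sch_three, map_add, Nat.cast_zero, zero_add, Nat.cast_one, sub_sub,
    one_add_one_eq_two]
  simp only [sub_sub] at h1 h2 h3
  norm_num at h1 h2 h3 ⊢
  rw [h1, h2, h3]
  split_ifs <;> ring

theorem hallP_dP_one_sch_four (hf : f ∈ rowSpan 2) {a b c d : ℤ} (hd : 1 ≤ d) (hdc : d ≤ c)
    (hcb : c ≤ b) (hba : b ≤ a) : hallP f (dP 1 (sch ![a, b - 1, c - 2, d - 3])) =
      if c = 1 then -hallP f (twoRow a b) else 0 := by
  rw [dP_sch_four, map_add, map_add, map_add,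
    hallP_sch_four_eq_zero hf (by push_cast; omega) (by omega) (by omega) (by omega),
    hallP_sch_four_eq_zero hf (by omega) (by push_cast; omega) (by omega) (by omega),
    zero_add, zero_add]
  norm_num
  have h1 : hallP f (sch ![a, b - 1, c - 2 - 2, d - 3]) =
      if c = 1 then -hallP f (twoRow a b) else 0 := by
    split_ifs with h
    · obtain rfl : d = 1 := by omega
      subst h
      rw [sch_four_swap]
      norm_num
      rw [sch_four_drop, sch_three_drop, sub_add_cancel]
    · exact hallP_sch_four_eq_zero hf (by omega) (by omega) (by omega) (by omega)
  have h2 : hallP f (sch ![a, b - 1, c - 2, d - 3 - 2]) = 0 := by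
    rcases eq_or_ne d 1 with rfl | h
    · rw [sch_eq_zero_of_neg _ (i := 3) (by simp), map_zero]
    rcases eq_or_ne c 1 with rfl | h'
    · omega
    exact hallP_sch_four_eq_zero_of_le hf (by omega) (by omega) (by omega) (by omega)
  rw [h1, h2, add_zero]

theorem hallP_dP_zero_dP_zero_sch_four (hf : f ∈ rowSpan 2) {a b c d : ℤ} (hd : 1 ≤ d)
    (hdc : d ≤ c) (hcb : c ≤ b) (hba : b ≤ a) :
    hallP f (dP 0 (dP 0 (sch ![a, b - 1, c - 2, d - 3]))) =
      if c = 1 then hallP f (twoRow a b) else 0 := by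
  have h0 := hallP_dP_one_sch_four hf hd hdc hcb hba
  have h1 : hallP f (sch ![a, b - 1, c - 2 - 1, d - 3 - 1]) =
      if c = 1 then hallP f (twoRow a b) else 0 := by
    split_ifs with h
    · obtain rfl : d = 1 := by omega
      subst h
      norm_num
      rw [sch_four_drop, sch_three_drop, sub_add_cancel]
    · exact hallP_sch_four_eq_zero_of_le hf (by omega) (by omega) (by omega) (by omega)
  have h2 : hallP f (sch ![a, b - 1 - 1, c - 2, d - 3 - 1]) = 0 :=
    hallP_sch_four_eq_zero_of_le hf (by omega) (by omega) (by omega) (by omega)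
  have h3 : hallP f (sch ![a - 1, b - 1, c - 2, d - 3 - 1]) = 0 :=
    hallP_sch_four_eq_zero_of_le hf (by omega) (by omega) (by omega) (by omega)
  have h4 : hallP f (sch ![a, b - 1 - 1, c - 2 - 1, d - 3]) = 0 :=
    hallP_sch_four_eq_zero hf (by omega) (by omega) (by omega) (by omega)
  have h5 : hallP f (sch ![a - 1, b - 1, c - 2 - 1, d - 3]) = 0 :=
    hallP_sch_four_eq_zero hf (by omega) (by omega) (by omega) (by omega)
  have h6 : hallP f (sch ![a - 1, b - 1 - 1, c - 2, d - 3]) = 0 :=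
    hallP_sch_four_eq_zero hf (by omega) (by omega) (by omega) (by omega)
  simp only [dP_sch_four, map_add, Nat.cast_zero, zero_add, Nat.cast_one, sub_sub,
    one_add_one_eq_two] at h0 ⊢
  simp only [sub_sub] at h1 h2 h3 h4 h5 h6
  norm_num at h0 h1 h2 h3 h4 h5 h6 ⊢
  rw [h1, h2, h3, h4, h5, h6]
  split_ifs at h0 ⊢ <;> linear_combination h0

end Rows

section Values

variable (n : ℕ) {a b c d : ℤ}

theorem hallP_toP_pleth_two_twoRow {p q : ℤ} (hq : 0 ≤ q) (hqp : q ≤ p) (hpq : p + q = 2 * n + 2)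
    (hp : 2 ≤ p) :
    hallP (toP (pleth (hh 2) (hh 1 * hh n))) (twoRow p q) =
      if q ≤ 1 then 1 else if q = p then 1 + (if q % 2 = 0 then 1 else -1)
        else 2 + (if q % 2 = 0 then 1 else -1) := by
  rw [hallP_toP_pleth_two]
  simp only [dP_twoRow, map_add, Nat.cast_zero, zero_add, Nat.cast_one, sub_sub,
    one_add_one_eq_two]
  rcases hqp.eq_or_lt with rfl | h
  · rw [twoRow_swap (q - 2), map_neg, map_neg,
      hallP_sq_twoRow n (p := q - 1) (q := q - 2 + 1) (by omega) (by omega) (by omega),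
      hallP_sq_twoRow n (p := q - 1) (q := q - 1) (by omega) (by omega) (by omega),
      hallP_sq_twoRow n (p := q) (q := q - 2) (by omega) (by omega) (by omega),
      hallP_frob_twoRow n (p := q - 1) (q := q - 2 + 1) (by omega) (by omega) (by omega),
      hallP_frob_twoRow n (p := q) (q := q - 2) (by omega) (by omega) (by omega)]
    split_ifs <;> first | omega | norm_num
  rw [hallP_sq_twoRow n (p := p - 2) (q := q) (by omega) (by omega) (by omega),
    hallP_frob_twoRow n (p := p - 2) (q := q) (by omega) (by omega) (by omega)]
  rcases hq.eq_or_lt with rfl | hq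
  · rw [twoRow_of_neg (by omega : (0 - 1 : ℤ) < 0), twoRow_of_neg (by omega : (0 - 2 : ℤ) < 0)]
    norm_num
  rw [hallP_sq_twoRow n (p := p - 1) (q := q - 1) (by omega) (by omega) (by omega)]
  rcases (show 1 ≤ q from hq).eq_or_lt with rfl | hq
  · rw [twoRow_of_neg (by omega : (1 - 2 : ℤ) < 0)]
    norm_num
  rw [hallP_sq_twoRow n (p := p) (q := q - 2) (by omega) (by omega) (by omega),
    hallP_frob_twoRow n (p := p) (q := q - 2) (by omega) (by omega) (by omega)]
  split_ifs <;> first | omega | norm_num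

theorem hallP_toP_pleth_two_sch_three (hc : 1 ≤ c) (hcb : c ≤ b) (hba : b ≤ a)
    (hn : a + b + c = 2 * n + 2) :
    hallP (toP (pleth (hh 2) (hh 1 * hh n))) (sch ![a, b - 1, c - 2]) =
      if c = 1 then if b = 1 then 1 else 2
      else if c = 2 ∧ b % 2 = 0 then 1 else 0 := by
  rw [hallP_toP_pleth_two, hallP_dP_zero_dP_zero_sch_three (hInP_mul_self_mem_rowSpan n) hc hcb hba,
    hallP_dP_one_sch_three (hInP_mul_self_mem_rowSpan n) hc hcb hba,
    hallP_dP_one_sch_three (frob_one_hInP_mem_rowSpan n) hc hcb hba]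
  rcases eq_or_ne c 1 with rfl | h1
  · simp only [if_true, OfNat.one_ne_ofNat, if_false]
    rw [hallP_sq_twoRow n (p := a - 1) (q := b) (by omega) (by omega) (by omega),
      hallP_sq_twoRow n (p := a) (q := b - 1) (by omega) (by omega) (by omega)]
    split_ifs with h
    · rw [hallP_sq_twoRow n (p := a) (q := 0) (by omega) (by omega) (by omega),
        hallP_frob_twoRow n (p := a) (q := 0) (by omega) (by omega) (by omega)]
      norm_num
    · norm_num
  rcases eq_or_ne c 2 with rfl | h2
  · rw [hallP_sq_twoRow n (p := a) (q := b) (by omega) (by omega) (by omega),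
      hallP_frob_twoRow n (p := a) (q := b) (by omega) (by omega) (by omega)]
    split_ifs <;> first | omega | norm_num
  · split_ifs <;> first | omega | norm_num

theorem hallP_toP_pleth_two_sch_four (hd : 1 ≤ d) (hdc : d ≤ c) (hcb : c ≤ b) (hba : b ≤ a)
    (hn : a + b + c + d = 2 * n + 2) :
    hallP (toP (pleth (hh 2) (hh 1 * hh n))) (sch ![a, b - 1, c - 2, d - 3]) =
      if c = 1 ∧ b % 2 = 1 then 1 else 0 := by
  rw [hallP_toP_pleth_two,
    hallP_dP_zero_dP_zero_sch_four (hInP_mul_self_mem_rowSpan n) hd hdc hcb hba,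
    hallP_dP_one_sch_four (frob_one_hInP_mem_rowSpan n) hd hdc hcb hba]
  rcases eq_or_ne c 1 with rfl | h1
  · rw [hallP_sq_twoRow n (p := a) (q := b) (by omega) (by omega) (by omega),
      hallP_frob_twoRow n (p := a) (q := b) (by omega) (by omega) (by omega)]
    split_ifs <;> first | omega | norm_num
  · simp [h1]

end Values

theorem toP_schur_singleton (a : ℕ) : toP (schur [a]) = twoRow a 0 := by
  rw [toP_schur, twoRow, hP_zero, hP_of_neg (z := 0 - 1) (by norm_num)]
  simp [sch]

theorem toP_schur_pair (a b : ℕ) : toP (schur [a, b]) = twoRow a b := by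
  rw [toP_schur]
  refine (sch_two _).trans ?_
  simp

theorem toP_schur_three (a b c : ℕ) :
    toP (schur [a, b, c]) = sch ![(a : ℤ), (b : ℤ) - 1, (c : ℤ) - 2] := by
  rw [toP_schur]
  refine congrArg (sch (N := 3)) ?_
  ext i
  fin_cases i <;> simp

theorem toP_schur_four (a b c d : ℕ) :
    toP (schur [a, b, c, d]) = sch ![(a : ℤ), (b : ℤ) - 1, (c : ℤ) - 2, (d : ℤ) - 3] := by
  rw [toP_schur]
  refine congrArg (sch (N := 4)) ?_
  ext i
  fin_cases i <;> simp

/-- `h_n[h₁²]` is Schur positive. -/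
theorem hallP_foulkesP_schur_nonneg {n : ℕ} {l : List ℕ} (hl : l.Pairwise (· ≥ ·))
    (hsum : l.sum = 2 * n) : 0 ≤ hallP (foulkesP n) (toP (schur l)) := by
  rw [toP_schur]
  refine hallP_foulkesP_nonneg _ n ?_ (fun i => by have := i.2; omega) ?_
  · intro i j hij
    have := List.pairwise_iff_get.mp hl i j hij
    have : (i : ℕ) < j := hij
    simp only
    omega
  · simp only [sub_add_cancel]
    rw [← hsum, ← Nat.cast_sum]
    congr 1
    simp [Fin.sum_univ_getElem]

theorem hallP_pleth_two_schur_of_five_le {m : ℕ} {l : List ℕ} (hlen : 5 ≤ l.length)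
    (hpos : ∀ a ∈ l, 0 < a) : hallP (toP (pleth (hh 2) (hh 1 * hh m))) (toP (schur l)) = 0 := by
  rw [toP_schur]
  refine hallP_sch_eq_zero_of_mem_rowSpan (toP_pleth_two_mem_rowSpan m) (by omega) _ fun i => ?_
  have := hpos _ (l.get_mem i)
  have := i.2
  omega

theorem hallP_pleth_two_le_hallP_foulkesP {m : ℕ} (hm : 2 ≤ m) {l : List ℕ}
    (hl : l.Pairwise (· ≥ ·)) (hpos : ∀ a ∈ l, 0 < a) (hsum : l.sum = 2 * (m + 1))
    (hne : l ≠ [2 * m, 2]) :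
    hallP (toP (pleth (hh 2) (hh 1 * hh m))) (toP (schur l)) ≤
      hallP (foulkesP (m + 1)) (toP (schur l)) := by
  have h0 := hallP_foulkesP_schur_nonneg hl hsum
  rcases l with _ | ⟨a, _ | ⟨b, _ | ⟨c, _ | ⟨d, _ | ⟨e, l⟩⟩⟩⟩⟩
  ·  simp at hsum
  · simp at hsum
    rw [toP_schur_singleton, hallP_toP_pleth_two_twoRow m (by omega) (by omega) (by omega)
      (by omega), hallP_foulkesP_twoRow (m + 1) (by omega) (by omega) (by omega)]
    norm_num
  · simp at hsum hl hpos hne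
    rw [toP_schur_pair, hallP_toP_pleth_two_twoRow m (by omega) (by omega) (by omega)
      (by omega), hallP_foulkesP_twoRow (m + 1) (by omega) (by omega) (by omega)]
    have h2 : b ≠ 2 := fun h => hne (by omega) h
    split_ifs <;> norm_cast <;> omega
  · simp at hsum hl hpos
    rw [toP_schur_three] at h0 ⊢
    rw [hallP_toP_pleth_two_sch_three m (by omega) (by omega) (by omega) (by omega)]
    split_ifs with h1 h2 h3
    · obtain rfl : c = 1 := by omega
      rw [show ((1 : ℕ) : ℤ) - 2 = -1 by norm_num,
        hallP_foulkesP_sch_three_one (m + 1) (by omega) (by omega) (by omega)]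
      norm_cast
      omega
    · obtain rfl : c = 1 := by omega
      rw [show ((1 : ℕ) : ℤ) - 2 = -1 by norm_num,
        hallP_foulkesP_sch_three_one (m + 1) (by omega) (by omega) (by omega)]
      norm_cast
      omega
    · rw [h3.1]
      exact hallP_foulkesP_sch_three_two (m + 1) (by omega) (by omega) (by omega) (by omega)
    · exact h0
  · simp at hsum hl hpos
    rw [toP_schur_four] at h0 ⊢
    rw [hallP_toP_pleth_two_sch_four m (by omega) (by omega) (by omega) (by omega) (by omega)]
    split_ifs with h
    · obtain rfl : d = 1 := by omega
      rw [h.1]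
      exact hallP_foulkesP_sch_four_one_one (m + 1) (by omega) (by omega) (by omega)
    · exact h0
  · rw [hallP_pleth_two_schur_of_five_le (by simp) hpos]
    exact h0

theorem pairwise_sortedParts {N : ℕ} (π : Nat.Partition N) :
    (sortedParts π).Pairwise (· ≥ ·) := by
  rw [sortedParts, List.pairwise_reverse]
  exact π.parts.pairwise_sort (· ≤ ·)

theorem coe_sortedParts {N : ℕ} (π : Nat.Partition N) : (sortedParts π : Multiset ℕ) = π.parts := by
  rw [sortedParts, Multiset.coe_reverse, Multiset.sort_eq]

end Foulkes

open Foulkes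

/-- The `m = 2` case of the paper's variant of the Foulkes conjecture: for `n > 2`
and every partition `λ` of `2n` with `λ ≠ (2n-2, 2)`,
`⟨h_n[h_1 h_1], s_λ⟩ ≥ ⟨h_2[h_1 h_{n-1}], s_λ⟩`; moreover
`⟨h_n[h_1 h_1], s_{(2n-2,2)}⟩ = 2` and `⟨h_2[h_1 h_{n-1}], s_{(2n-2,2)}⟩ = 3`. -/
theorem foulkes_variant_m_eq_two (n : ℕ) (hn : 2 < n) :
    (∀ π : Nat.Partition (2 * n), π.parts ≠ {2 * n - 2, 2} →
      hall (pleth (hh 2) (hh 1 * hh (n - 1))) (schur (sortedParts π)) ≤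
        hall (pleth (hh n) (hh 1 * hh 1)) (schur (sortedParts π))) ∧
    hall (pleth (hh n) (hh 1 * hh 1)) (schur [2 * n - 2, 2]) = 2 ∧
    hall (pleth (hh 2) (hh 1 * hh (n - 1))) (schur [2 * n - 2, 2]) = 3 := by
  obtain ⟨m, rfl⟩ : ∃ m, n = m + 1 := ⟨n - 1, by omega⟩
  rw [Nat.add_sub_cancel, show 2 * (m + 1) - 2 = 2 * m by omega]
  simp only [hall_eq, toP_pleth_hh_sq, toP_schur_pair]
  refine ⟨fun π hπ => ?_, ?_, ?_⟩
  · refine hallP_pleth_two_le_hallP_foulkesP (by omega) (pairwise_sortedParts π)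
      (fun a ha => π.parts_pos ?_) ?_ fun h => hπ ?_
    · rwa [← coe_sortedParts, Multiset.mem_coe]
    · rw [← Multiset.sum_coe, coe_sortedParts, π.parts_sum]
    · rw [← coe_sortedParts, h]
      rfl
  · rw [hallP_foulkesP_twoRow (m + 1) (by push_cast; ring) (by norm_num) (by push_cast; omega)]
    norm_num
  · rw [hallP_toP_pleth_two_twoRow m (by norm_num) (by push_cast; omega) (by push_cast; ring)
      (by push_cast; omega), if_neg (by norm_num), if_neg (by push_cast; omega)]
    norm_num
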